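/- Let H be a separable real Hilbert space and let T : H → H be a positive self-adjoint compact operator whose eigenvalues {λ_n}_{n≥1} (arranged in non-increasing order, counted with multiplicity) satisfy λ_n = c₁ n^{-α₁} + c₂ n^{-α₂} + o(n^{-α₂}) as n → ∞, where c₁ > 0, c₂ ∈ ℝ, α₁, α₂ > 0, and either α₁ < α₂ < α₁ + 1/2, or α₁ = α₂ and c₂ = 0. Then the entropy of T satisfies H(ε;T) = (α₁ c₁^{1/α₁} / ln 2) · ε^{-1/α₁} + (c₂ c₁^{(1-α₂)/α₁} / (ln 2 · (α₁-α₂+1))) · ε^{-(α₁-α₂+1)/α₁} + o(ε^{-(α₁-α₂+1)/α₁}) as ε → 0. -/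

import Mathlib

open MeasureTheory Filter Asymptotics Topology TopologicalSpace
open scoped BigOperators ENNReal NNReal

noncomputable section

/-- The `ε`-covering number of a set `K` in a (pseudo)metric space: the minimal cardinality of a
finite set of points such that every point of `K` lies within distance `ε` of one of them. -/
def coveringNumber {X : Type*} [PseudoMetricSpace X] (ε : ℝ) (K : Set X) : ℕ :=
  sInf {n : ℕ | ∃ s : Finset X, s.card = n ∧ ∀ x ∈ K, ∃ y ∈ s, dist x y ≤ ε}

/-- The metric entropy `H(ε; K) = log₂ N(ε; K)`. -/
def metricEntropy {X : Type*} [PseudoMetricSpace X] (ε : ℝ) (K : Set X) : ℝ :=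
  Real.logb 2 (coveringNumber ε K)

/-- The entropy of a continuous linear operator: the metric entropy of the closure of the image
of the closed unit ball. -/
def opEntropy {H : Type*} [NormedAddCommGroup H] [InnerProductSpace ℝ H]
    (ε : ℝ) (T : H →L[ℝ] H) : ℝ :=
  metricEntropy ε (closure (T '' Metric.closedBall 0 1))

/-- Greedy covering: if every set `S x`, `x ∈ X`, has probability at least `p`, then `n` points
can be chosen so that at most `(1 - p) ^ n * #X` of these sets contain none of them. -/
lemma exists_finset_card_unhit_le {α E : Type*} [MeasurableSpace E] (μ : Measure E)
    [IsProbabilityMeasure μ] (S : α → Set E) (hS : ∀ x, MeasurableSet (S x)) (X : Finset α)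
    {p : ℝ} (hp : ∀ x ∈ X, p ≤ μ.real (S x)) (n : ℕ) :
    ∃ C : Finset E, C.card ≤ n ∧ ∃ Y ⊆ X, (∀ x ∈ X, x ∉ Y → ∃ c ∈ C, c ∈ S x) ∧
      (Y.card : ℝ) ≤ (1 - p) ^ n * X.card := by
  classical
  induction n with
  | zero => exact ⟨∅, by simp, X, subset_rfl, by simp_all, by simp⟩
  | succ n ih =>
    obtain ⟨C, hC, Y, hYX, hcov, hY⟩ := ih
    rcases Y.eq_empty_or_nonempty with rfl | ⟨y, hy⟩
    · refine ⟨C, hC.trans n.le_succ, ∅, by simp, hcov, ?_⟩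
      rcases X.eq_empty_or_nonempty with rfl | ⟨x, hx⟩
      · simp
      · have : 0 ≤ 1 - p := sub_nonneg.2 ((hp x hx).trans measureReal_le_one)
        simpa using by positivity
    have hp1 : 0 ≤ 1 - p := sub_nonneg.2 ((hp y (hYX hy)).trans measureReal_le_one)
    have hindic : ∀ x ∈ Y, Integrable ((S x).indicator (fun _ => (1 : ℝ))) μ := fun x _ =>
      (integrable_const _).indicator (hS x)
    obtain ⟨c, hc⟩ := exists_integral_le
      (integrable_finsetSum Y hindic)
    refine ⟨insert c C, (Finset.card_insert_le _ _).trans (by omega), Y.filter (c ∉ S ·),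
      (Finset.filter_subset _ _).trans hYX, ?_, ?_⟩
    · intro x hx hxY
      by_cases h : x ∈ Y
      · exact ⟨c, by simp, by simpa [h] using hxY⟩
      · obtain ⟨c', h1, h2⟩ := hcov x hx h
        exact ⟨c', by simp [h1], h2⟩
    · rw [integral_finsetSum _ hindic] at hc
      simp only [integral_indicator_const _ (hS _), smul_eq_mul,
        mul_one] at hc
      have h1 : (Y.card : ℝ) * p ≤ ∑ x ∈ Y, μ.real (S x) := by
        simpa using Finset.card_nsmul_le_sum Y _ p (fun x hx => hp x (hYX hx))
      have h2 : ∑ x ∈ Y, (S x).indicator (fun _ => (1 : ℝ)) c = (Y.filter (c ∈ S ·)).card := by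
        simp [Set.indicator_apply]
      have h3 : ((Y.filter (c ∈ S ·)).card : ℝ) + (Y.filter (c ∉ S ·)).card = Y.card := by
        exact_mod_cast Finset.card_filter_add_card_filter_not (s := Y) (c ∈ S ·)
      have : ((Y.filter (c ∉ S ·)).card : ℝ) ≤ (1 - p) * Y.card := by
        rw [h2] at hc; linarith
      calc _ ≤ (1 - p) * Y.card := this
        _ ≤ (1 - p) * ((1 - p) ^ n * X.card) := by gcongr
        _ = _ := by ring

/-- A net of the Euclidean unit ball, inside the ball, obtained by rounding coordinates. -/
lemma exists_net_unitBall (m M : ℕ) (hM : 0 < M) :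
    ∃ X : Finset (EuclideanSpace ℝ (Fin m)), X.card ≤ (2 * M + 1) ^ m ∧ (∀ x ∈ X, ‖x‖ ≤ 1) ∧
      ∀ x : EuclideanSpace ℝ (Fin m), ‖x‖ ≤ 1 → ∃ y ∈ X, dist x y ≤ √m / M := by
  classical
  let f : EuclideanSpace ℝ (Fin m) → (Fin m → ℤ) := fun x i => ⌊M * x i⌋
  let D : Finset (Fin m → ℤ) := Fintype.piFinset fun _ => Finset.Icc (-(M : ℤ)) M
  have hfD : ∀ x : EuclideanSpace ℝ (Fin m), ‖x‖ ≤ 1 → f x ∈ D := by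
    intro x hx
    simp only [D, f, Fintype.mem_piFinset, Finset.mem_Icc]
    intro i
    have h := (PiLp.norm_apply_le x i).trans hx
    rw [Real.norm_eq_abs, abs_le] at h
    have hM' : (0 : ℝ) < M := by exact_mod_cast hM
    constructor
    · rw [Int.le_floor]; push_cast; nlinarith
    · have : (⌊M * x i⌋ : ℝ) ≤ M := (Int.floor_le _).trans (by nlinarith)
      exact_mod_cast this
  have hrep : ∀ k : Fin m → ℤ, ∃ y : EuclideanSpace ℝ (Fin m), ‖y‖ ≤ 1 ∧
      ∀ x : EuclideanSpace ℝ (Fin m), ‖x‖ ≤ 1 → f x = k → f y = k := by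
    intro k
    by_cases h : ∃ x : EuclideanSpace ℝ (Fin m), ‖x‖ ≤ 1 ∧ f x = k
    · obtain ⟨x, hx, hk⟩ := h
      exact ⟨x, hx, fun _ _ _ => hk⟩
    · push Not at h
      exact ⟨0, by simp, fun x hx hk => absurd hk (h x hx)⟩
  choose g hg1 hg2 using hrep
  refine ⟨D.image g, Finset.card_image_le.trans ?_, ?_, ?_⟩
  · simp only [D, Fintype.card_piFinset, Int.card_Icc, Finset.prod_const, Finset.card_univ,
      Fintype.card_fin]
    gcongr; omega
  · intro x hx
    obtain ⟨k, -, rfl⟩ := Finset.mem_image.1 hx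
    exact hg1 k
  · intro x hx
    refine ⟨g (f x), Finset.mem_image_of_mem _ (hfD x hx), ?_⟩
    have hM' : (0 : ℝ) < M := by exact_mod_cast hM
    have hfl := hg2 (f x) x hx rfl
    rw [EuclideanSpace.dist_eq]
    have hi : ∀ i, dist (x i) (g (f x) i) ^ 2 ≤ (1 / M : ℝ) ^ 2 := by
      intro i
      have := Int.abs_sub_lt_one_of_floor_eq_floor (congrFun hfl i)
      rw [← mul_sub, abs_mul, abs_of_pos hM', abs_sub_comm] at this
      rw [Real.dist_eq]
      gcongr
      rw [le_div_iff₀ hM']; linarith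
    calc √(∑ i, dist (x i) (g (f x) i) ^ 2) ≤ √(∑ _i : Fin m, (1 / M : ℝ) ^ 2) := by
          exact Real.sqrt_le_sqrt (Finset.sum_le_sum fun i _ => hi i)
      _ = √m / M := by
          rw [Finset.sum_const, Finset.card_univ, Fintype.card_fin, nsmul_eq_mul,
            Real.sqrt_mul (by positivity), Real.sqrt_sq (by positivity)]
          ring

lemma quarter_le_div_add_one_pow (m : ℕ) : (1 / 4 : ℝ) ≤ ((m : ℝ) / (m + 1)) ^ m := by
  rcases Nat.eq_zero_or_pos m with rfl | hm
  · norm_num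
  have hm' : (0 : ℝ) < m := by exact_mod_cast hm
  have h : (((m : ℝ) + 1) / m) ^ m ≤ 4 := by
    calc (((m : ℝ) + 1) / m) ^ m ≤ Real.exp (1 / m) ^ m := by
          gcongr
          have := Real.add_one_le_exp (1 / (m : ℝ))
          rw [add_div, div_self hm'.ne']; linarith
      _ = Real.exp 1 := by rw [← Real.exp_nat_mul]; congr 1; field_simp
      _ ≤ 4 := by linarith [Real.exp_one_lt_d9]
  rw [← inv_div ((m : ℝ) + 1) m, inv_pow, one_div]
  exact inv_anti₀ (by positivity) h

/-- The squared norm after replacing the component along the unit vector `e`. -/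
lemma norm_sq_add_smul_sub_le {F : Type*} [NormedAddCommGroup F] [InnerProductSpace ℝ F]
    {e w : F} (he : ‖e‖ = 1) (hw : ‖w‖ ≤ 1) (A b : ℝ) :
    ‖b • e + A • (w - (inner ℝ e w) • e)‖ ^ 2 ≤ b ^ 2 + A ^ 2 := by
  have h1 : inner ℝ e e = (1 : ℝ) := by rw [real_inner_self_eq_norm_sq, he]; norm_num
  have h0 : inner ℝ e (w - (inner ℝ e w) • e) = (0 : ℝ) := by
    rw [inner_sub_right, real_inner_smul_right, h1]; ring
  have h2 : ‖w - (inner ℝ e w) • e‖ ^ 2 ≤ 1 := by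
    rw [norm_sub_sq_real, real_inner_smul_right, real_inner_comm, norm_smul, he, Real.norm_eq_abs,
      mul_one, sq_abs]
    nlinarith [norm_nonneg w, sq_nonneg (inner ℝ e w : ℝ)]
  rw [norm_add_sq_real, norm_smul, norm_smul, he, mul_pow, mul_pow, real_inner_smul_left,
    real_inner_smul_right, h0]
  simp only [Real.norm_eq_abs, sq_abs]
  nlinarith [sq_nonneg A]

/-- If `‖x‖ ≤ 1` and `ρ² + R² = 1`, the ball of radius `ρ` about `x` occupies at least a fraction
of order `ρ ^ m` of the ball of radius `R` about the origin. -/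
lemma volume_lens_ge {m : ℕ} (hm : 0 < m) {ρ R : ℝ} (hρ : 0 < ρ) (hR : 0 < R)
    (hρR : ρ ^ 2 + R ^ 2 = 1) {x : EuclideanSpace ℝ (Fin m)} (hx : ‖x‖ ≤ 1) :
    ρ ^ (m + 1) * R / (6 * (m + 1)) * volume.real (Metric.closedBall (0 : EuclideanSpace ℝ (Fin m)) R)
      ≤ volume.real (Metric.closedBall 0 R ∩ Metric.closedBall x ρ) := by
  have : Nonempty (Fin m) := ⟨⟨0, hm⟩⟩
  obtain ⟨e, he, hxe⟩ : ∃ e : EuclideanSpace ℝ (Fin m), ‖e‖ = 1 ∧ x = ‖x‖ • e := by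
    by_cases h : x = 0
    · obtain ⟨e, he⟩ := exists_norm_eq (EuclideanSpace ℝ (Fin m)) zero_le_one
      exact ⟨e, he, by simp [h]⟩
    · exact ⟨‖x‖⁻¹ • x, norm_smul_inv_norm h, by rw [smul_inv_smul₀ (norm_ne_zero_iff.2 h)]⟩
  set s := ‖x‖ with hs
  have hs0 : 0 ≤ s := norm_nonneg x
  have hm1 : (0 : ℝ) < m + 1 := by positivity
  set q : ℝ := m / (m + 1) with hq
  have hm0 : (0 : ℝ) < m := by exact_mod_cast hm
  have hq0 : 0 < q := by positivity
  set A : ℝ := ρ * R * √q with hA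
  set t : ℝ := ρ ^ 2 * R ^ 2 / (3 * (m + 1)) with ht
  have hA0 : 0 < A := by positivity
  have ht0 : 0 < t := by positivity
  have hA2 : A ^ 2 = ρ ^ 2 * R ^ 2 * q := by rw [hA, mul_pow, mul_pow, Real.sq_sqrt hq0.le]
  have h3t : 3 * t + A ^ 2 = ρ ^ 2 * R ^ 2 := by rw [hA2, ht, hq]; field_simp; ring
  have hρ1 : ρ ^ 2 ≤ 1 := by nlinarith
  have hR1 : R ^ 2 ≤ 1 := by nlinarith
  have ht1 : t ≤ 1 := by nlinarith [sq_nonneg A, mul_le_mul hρ1 hR1 (by positivity) zero_le_one]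
  let Λ : EuclideanSpace ℝ (Fin m) →ₗ[ℝ] EuclideanSpace ℝ (Fin m) :=
    A • LinearMap.transvection (innerSL ℝ e).toLinearMap ((t / A - 1) • e)
  have hΛ : ∀ w, Λ w = (t * inner ℝ e w) • e + A • (w - (inner ℝ e w : ℝ) • e) := by
    intro w
    simp only [Λ, LinearMap.smul_apply, LinearMap.transvection.apply]
    simp only [ContinuousLinearMap.coe_coe, innerSL_apply_apply]
    match_scalars <;> field_simp
    ring
  have hdet : Λ.det = A ^ m * (t / A) := by
    simp only [Λ, LinearMap.det_smul, LinearMap.transvection.det]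
    simp [he]
  have hsub : (fun y => R ^ 2 • x + y) '' (Λ '' Metric.closedBall 0 1) ⊆
      Metric.closedBall 0 R ∩ Metric.closedBall x ρ := by
    rintro _ ⟨_, ⟨w, hw, rfl⟩, rfl⟩
    rw [mem_closedBall_zero_iff] at hw
    have ha : |(inner ℝ e w : ℝ)| ≤ 1 := by
      have := abs_real_inner_le_norm e w
      rw [he, one_mul] at this; exact this.trans hw
    rw [abs_le] at ha
    set a : ℝ := inner ℝ e w with hadef
    have hta : -t ≤ t * a ∧ t * a ≤ t := by constructor <;> nlinarith
    constructor
    · rw [mem_closedBall_zero_iff]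
      refine (sq_le_sq₀ (norm_nonneg _) hR.le).1 ?_
      have e1 : R ^ 2 • x + Λ w = (R ^ 2 * s + t * a) • e + A • (w - a • e) := by
        rw [hΛ, hxe]; module
      show ‖R ^ 2 • x + Λ w‖ ^ 2 ≤ R ^ 2
      rw [e1]
      refine (norm_sq_add_smul_sub_le he hw A _).trans ?_
      have hb : (R ^ 2 * s + t * a) ^ 2 ≤ (R ^ 2 + t) ^ 2 := by
        apply sq_le_sq'
        · linarith [mul_nonneg (sq_nonneg R) hs0, sq_nonneg R]
        · linarith [mul_le_of_le_one_right (sq_nonneg R) hx]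
      have h1 : R ^ 2 * (ρ ^ 2 + R ^ 2) = R ^ 2 := by rw [hρR, mul_one]
      linarith [mul_nonneg ht0.le (sub_nonneg.2 hR1), mul_nonneg ht0.le (sub_nonneg.2 ht1)]
    · rw [mem_closedBall_iff_norm']
      refine (sq_le_sq₀ (norm_nonneg _) hρ.le).1 ?_
      have e1 : x - (R ^ 2 • x + Λ w) = (ρ ^ 2 * s - t * a) • e + (-A) • (w - a • e) := by
        have : ρ ^ 2 = 1 - R ^ 2 := by linarith
        rw [hΛ, this, hxe]; module
      show ‖x - (R ^ 2 • x + Λ w)‖ ^ 2 ≤ ρ ^ 2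
      rw [e1]
      refine (norm_sq_add_smul_sub_le he hw (-A) _).trans ?_
      have hb : (ρ ^ 2 * s - t * a) ^ 2 ≤ (ρ ^ 2 + t) ^ 2 := by
        apply sq_le_sq'
        · linarith [mul_nonneg (sq_nonneg ρ) hs0, sq_nonneg ρ]
        · linarith [mul_le_of_le_one_right (sq_nonneg ρ) hx]
      have h1 : ρ ^ 2 * (ρ ^ 2 + R ^ 2) = ρ ^ 2 := by rw [hρR, mul_one]
      linarith [mul_nonneg ht0.le (sub_nonneg.2 hρ1), mul_nonneg ht0.le (sub_nonneg.2 ht1)]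
  have hfin : volume (Metric.closedBall (0 : EuclideanSpace ℝ (Fin m)) R ∩ Metric.closedBall x ρ)
      ≠ ∞ := ((measure_mono Set.inter_subset_left).trans_lt measure_closedBall_lt_top).ne
  refine le_trans ?_ (measureReal_mono hsub hfin)
  rw [Set.image_add_left, measureReal_def, measureReal_def, measure_preimage_add,
    Measure.addHaar_image_linearMap, hdet, Measure.addHaar_closedBall _ _ hR.le,
    Measure.addHaar_closedBall _ _ zero_le_one, finrank_euclideanSpace_fin]
  simp only [one_pow, ENNReal.ofReal_one, one_mul, ENNReal.toReal_mul]
  rw [ENNReal.toReal_ofReal (by positivity), ENNReal.toReal_ofReal (by positivity),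
    abs_of_pos (by positivity), ← mul_assoc]
  refine mul_le_mul_of_nonneg_right ?_ ENNReal.toReal_nonneg
  have hsq : √q ≤ 1 := by
    rw [Real.sqrt_le_one, hq, div_le_one hm1]; linarith
  have hqm : 1 / 2 ≤ √q ^ m := by
    have h := quarter_le_div_add_one_pow m
    rw [← hq] at h
    have h4 : (1 / 2 : ℝ) ^ 2 ≤ (√q ^ m) ^ 2 := by
      rw [← pow_mul, mul_comm m 2, pow_mul, Real.sq_sqrt hq0.le]; linarith
    exact (sq_le_sq₀ (by norm_num) (by positivity)).1 h4
  have htA : ρ * R / (3 * (m + 1)) ≤ t / A := by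
    rw [le_div_iff₀ hA0, hA, ht]
    calc ρ * R / (3 * (m + 1)) * (ρ * R * √q) ≤ ρ * R / (3 * (m + 1)) * (ρ * R * 1) := by gcongr
      _ = _ := by ring
  calc ρ ^ (m + 1) * R / (6 * (m + 1)) * R ^ m
      = ((ρ * R) ^ m * (1 / 2)) * (ρ * R / (3 * (m + 1))) := by field_simp; ring
    _ ≤ ((ρ * R) ^ m * √q ^ m) * (t / A) := by gcongr
    _ = A ^ m * (t / A) := by rw [hA, mul_pow (ρ * R)]

/-- Covering the Euclidean unit ball by balls of radius `r`, up to polynomial factors as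
efficiently as the volume allows. -/
lemma exists_cover_unitBall {m : ℕ} (hm : 0 < m) {r : ℝ} (hr : 0 < r) (hr1 : r ≤ 1) :
    ∃ C : Finset (EuclideanSpace ℝ (Fin m)), (C.card : ℝ) ≤ 241 * (m + 1) ^ 5 / r ^ (m + 2) ∧
      ∀ x : EuclideanSpace ℝ (Fin m), ‖x‖ ≤ 1 → ∃ c ∈ C, dist x c ≤ r := by
  have hm0 : (1 : ℝ) ≤ m := by exact_mod_cast hm
  have hm1 : (0 : ℝ) < m + 1 := by positivity
  set ρ : ℝ := r * (m / (m + 1)) with hρdef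
  have hq1 : (m : ℝ) / (m + 1) = 1 - 1 / (m + 1) := by field_simp; ring
  have hi0 : 0 < 1 / ((m : ℝ) + 1) := by positivity
  have hi1 : 1 / ((m : ℝ) + 1) ≤ 1 / 2 := by gcongr; linarith
  have hρ : 0 < ρ := by positivity
  have hρ1 : ρ ≤ 1 - 1 / (m + 1) := by
    rw [hρdef, ← hq1]; exact mul_le_of_le_one_left (by positivity) hr1
  set R : ℝ := √(1 - ρ ^ 2) with hRdef
  have hR1 : 1 / (m + 1) ≤ R := by
    apply Real.le_sqrt_of_sq_le; nlinarith
  have hR : 0 < R := hi0.trans_le hR1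
  have hρR : ρ ^ 2 + R ^ 2 = 1 := by rw [hRdef, Real.sq_sqrt (by nlinarith)]; ring
  set p : ℝ := r ^ (m + 1) / (48 * (m + 1) ^ 2) with hp
  have hp0 : 0 < p := by positivity
  have hpρ : p ≤ ρ ^ (m + 1) * R / (6 * (m + 1)) := by
    calc p = r ^ (m + 1) * (1 / 4 * (1 / 2)) * (1 / (m + 1)) / (6 * (m + 1)) := by
          rw [hp]; field_simp; ring
      _ ≤ r ^ (m + 1) * ((m / (m + 1)) ^ m * (m / (m + 1))) * R / (6 * (m + 1)) := by
          have h1 := quarter_le_div_add_one_pow m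
          have h2 : (1 / 2 : ℝ) ≤ m / (m + 1) := by rw [hq1]; linarith
          gcongr
      _ = _ := by rw [hρdef, mul_pow, ← pow_succ]
  set M : ℕ := ⌈((m : ℝ) + 1) ^ 2 / r⌉₊ with hMdef
  have hMr : ((m : ℝ) + 1) ^ 2 / r ≤ M := Nat.le_ceil _
  have hM0 : (0 : ℝ) < M := lt_of_lt_of_le (by positivity) hMr
  have hM : 0 < M := by exact_mod_cast hM0
  obtain ⟨X, hXcard, hX1, hXnet⟩ := exists_net_unitBall m M hM
  have hnet : √m / M ≤ r * (1 / (m + 1)) := by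
    rw [div_le_iff₀ hM0]
    have h1 : √(m : ℝ) ≤ m + 1 := by
      rw [Real.sqrt_le_left (by positivity)]; nlinarith
    calc √(m : ℝ) ≤ m + 1 := h1
      _ = r * (1 / (m + 1)) * (((m : ℝ) + 1) ^ 2 / r) := by field_simp
      _ ≤ _ := by gcongr
  have hvol : volume (Metric.closedBall (0 : EuclideanSpace ℝ (Fin m)) R) ≠ 0 :=
    (Metric.measure_closedBall_pos _ _ hR).ne'
  have hvolt : volume (Metric.closedBall (0 : EuclideanSpace ℝ (Fin m)) R) ≠ ∞ :=
    measure_closedBall_lt_top.ne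
  let μ := ProbabilityTheory.cond (volume : Measure (EuclideanSpace ℝ (Fin m)))
    (Metric.closedBall 0 R)
  have : IsProbabilityMeasure μ := ProbabilityTheory.cond_isProbabilityMeasure_of_finite hvol hvolt
  have hμ : ∀ x ∈ X, p ≤ μ.real (Metric.closedBall x ρ) := by
    intro x hx
    refine hpρ.trans ?_
    have h := volume_lens_ge hm hρ hR hρR (hX1 x hx)
    rw [measureReal_def, ProbabilityTheory.cond_apply Metric.isClosed_closedBall.measurableSet,
      ENNReal.toReal_mul, ENNReal.toReal_inv, le_inv_mul_iff₀ (ENNReal.toReal_pos hvol hvolt), mul_comm]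
    exact h
  set n : ℕ := ⌊Real.log X.card / p⌋₊ + 1 with hn
  obtain ⟨C, hCn, Y, hYX, hcov, hY⟩ := exists_finset_card_unhit_le μ
    (fun x => Metric.closedBall x ρ) (fun x => Metric.isClosed_closedBall.measurableSet) X hμ n
  have hXne : X.Nonempty := by
    obtain ⟨y, hy, -⟩ := hXnet 0 (by simp)
    exact ⟨y, hy⟩
  have hXpos : (0 : ℝ) < X.card := by exact_mod_cast hXne.card_pos
  have hp1 : p ≤ 1 := by
    obtain ⟨y, hy⟩ := hXne
    exact (hμ y hy).trans measureReal_le_one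
  have hYe : Y = ∅ := by
    rw [← Finset.card_eq_zero]
    have hlt : (Y.card : ℝ) < 1 := by
      refine hY.trans_lt ?_
      calc (1 - p) ^ n * X.card ≤ Real.exp (-p) ^ n * X.card := by
            gcongr
            exact Real.one_sub_le_exp_neg p
        _ = Real.exp (-(p * n) + Real.log X.card) := by
            rw [Real.exp_add, Real.exp_log hXpos, ← Real.exp_nat_mul]; ring_nf
        _ < 1 := by
            rw [Real.exp_lt_one_iff]
            have := Nat.lt_floor_add_one (Real.log X.card / p)
            rw [div_lt_iff₀ hp0] at this
            rw [hn]; push_cast; linarith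
    exact_mod_cast Nat.lt_one_iff.1 (by exact_mod_cast hlt)
  subst hYe
  refine ⟨C, ?_, ?_⟩
  · have hlog : Real.log X.card ≤ 5 * (m + 1) ^ 3 / r := by
      have hM2 : (2 * M + 1 : ℝ) ≤ 5 * (m + 1) ^ 2 / r := by
        have h1 : (M : ℝ) < ((m : ℝ) + 1) ^ 2 / r + 1 := Nat.ceil_lt_add_one (by positivity)
        have h2 : 1 ≤ ((m : ℝ) + 1) ^ 2 / r := by
          rw [le_div_iff₀ hr]; nlinarith
        have h3 : 5 * ((m : ℝ) + 1) ^ 2 / r = 5 * (((m : ℝ) + 1) ^ 2 / r) := by ring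
        rw [h3]; linarith
      calc Real.log X.card ≤ Real.log ((2 * M + 1 : ℝ) ^ m) := by
            apply Real.log_le_log hXpos; exact_mod_cast hXcard
        _ = m * Real.log (2 * M + 1) := by rw [Real.log_pow]
        _ ≤ (m + 1) * (5 * (m + 1) ^ 2 / r) := by
            have h1 := Real.log_le_self (x := 2 * M + 1) (by positivity)
            have h2 : 0 ≤ Real.log (2 * M + 1) := Real.log_nonneg (by linarith)
            gcongr
            · linarith
            · exact h1.trans hM2
        _ = _ := by ring
    have hlog0 : 0 ≤ Real.log X.card := Real.log_nonneg (by exact_mod_cast hXne.card_pos)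
    have h1r : 1 ≤ (m + 1) ^ 5 / r ^ (m + 2) := by
      rw [le_div_iff₀ (by positivity), one_mul]
      exact (pow_le_one₀ hr.le hr1).trans (one_le_pow₀ (by linarith))
    calc (C.card : ℝ) ≤ n := by exact_mod_cast hCn
      _ ≤ Real.log X.card / p + 1 := by
          rw [hn]; push_cast; gcongr; exact Nat.floor_le (by positivity)
      _ ≤ 5 * (m + 1) ^ 3 / r / p + (m + 1) ^ 5 / r ^ (m + 2) := by gcongr
      _ = _ := by rw [hp]; field_simp; ring
  · intro x hx
    obtain ⟨y, hy, hxy⟩ := hXnet x hx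
    obtain ⟨c, hc, hcy⟩ := hcov y hy (by simp)
    refine ⟨c, hc, ?_⟩
    rw [Metric.mem_closedBall, dist_comm] at hcy
    calc dist x c ≤ dist x y + dist y c := dist_triangle _ _ _
      _ ≤ r * (1 / (m + 1)) + r * (m / (m + 1)) := add_le_add (hxy.trans hnet) hcy
      _ = r := by rw [hq1]; ring

/-- Quantizing one block of coordinates: the energy of the block is rounded up to a multiple
`j / L` and the normalized block is replaced by a centre of a cover of the unit ball. -/
lemma exists_block_code {m L : ℕ} (hL : 0 < L) {δ μ : ℝ} (hδ : 0 ≤ δ) (hμ : 0 < μ)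
    {C : Finset (EuclideanSpace ℝ (Fin m))}
    (hC : ∀ x : EuclideanSpace ℝ (Fin m), ‖x‖ ≤ 1 → ∃ c ∈ C, dist x c ≤ δ / μ)
    (l b : Fin m → ℝ) (hl0 : ∀ i, 0 ≤ l i) (hl : ∀ i, l i ≤ μ) (hb : ∑ i, b i ^ 2 ≤ 1) :
    ∃ j : Fin (L + 1), ∃ c ∈ C,
      ∑ i, (l i * b i - μ * √(j / L) * c i) ^ 2 ≤ δ ^ 2 * (∑ i, b i ^ 2 + 1 / L) := by
  have hL' : (0 : ℝ) < L := by exact_mod_cast hL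
  set S := ∑ i, b i ^ 2 with hS
  have hS0 : 0 ≤ S := Finset.sum_nonneg fun i _ => sq_nonneg _
  have hjle : ⌈L * S⌉₊ ≤ L := by
    rw [Nat.ceil_le]; nlinarith
  set j : Fin (L + 1) := ⟨⌈L * S⌉₊, by omega⟩ with hj
  have hSj : S ≤ (j : ℕ) / L := by
    rw [le_div_iff₀ hL', mul_comm]; exact Nat.le_ceil _
  have hjS : ((j : ℕ) : ℝ) / L ≤ S + 1 / L := by
    rw [div_le_iff₀ hL', add_mul, one_div_mul_cancel hL'.ne', mul_comm S]
    exact (Nat.ceil_lt_add_one (by positivity)).le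
  set w : ℝ := √((j : ℕ) / L) with hw
  have hw2 : w ^ 2 = (j : ℕ) / L := Real.sq_sqrt (by positivity)
  have hw0 : 0 ≤ w := Real.sqrt_nonneg _
  have hvb : ∀ i, (l i * b i / (μ * w)) * (μ * w) = l i * b i := by
    intro i
    by_cases h : w = 0
    · have : S = 0 := by
        apply le_antisymm _ hS0
        rw [← hw2, h] at hSj; simpa using hSj
      have hbi : b i ^ 2 = 0 :=
        (Finset.sum_eq_zero_iff_of_nonneg (fun i _ => sq_nonneg (b i))).1 this i (Finset.mem_univ i)
      have : b i = 0 := by simpa using hbi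
      simp [this]
    · exact div_mul_cancel₀ _ (mul_ne_zero hμ.ne' h)
  obtain ⟨c, hcC, hc⟩ := hC (WithLp.toLp 2 fun i => l i * b i / (μ * w)) (by
    rw [EuclideanSpace.norm_eq, Real.sqrt_le_one]
    simp only [Real.norm_eq_abs, sq_abs]
    by_cases h : w = 0
    · simp [h]
    have hw0 : 0 < w := lt_of_le_of_ne hw0 (Ne.symm h)
    calc ∑ i, (l i * b i / (μ * w)) ^ 2 ≤ ∑ i, b i ^ 2 / w ^ 2 := by
          refine Finset.sum_le_sum fun i _ => ?_
          have : l i ^ 2 ≤ μ ^ 2 := pow_le_pow_left₀ (hl0 i) (hl i) 2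
          rw [div_pow, mul_pow, mul_pow, ← div_div]
          gcongr
          rw [div_le_iff₀ (by positivity), mul_comm]
          gcongr
      _ = S / w ^ 2 := by rw [hS, Finset.sum_div]
      _ ≤ 1 := by rw [div_le_one (by positivity), hw2]; exact hSj)
  refine ⟨j, c, hcC, ?_⟩
  rw [EuclideanSpace.dist_eq] at hc
  have hc2 : ∑ i, (l i * b i / (μ * w) - c i) ^ 2 ≤ (δ / μ) ^ 2 := by
    have := (Real.sqrt_le_left (by positivity)).1 hc
    simpa [Real.dist_eq, sq_abs] using this
  calc ∑ i, (l i * b i - μ * w * c i) ^ 2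
      = (μ * w) ^ 2 * ∑ i, (l i * b i / (μ * w) - c i) ^ 2 := by
        rw [Finset.mul_sum]
        refine Finset.sum_congr rfl fun i _ => ?_
        rw [← mul_pow, mul_sub, mul_comm (μ * w) (_ / _), hvb]
    _ ≤ (μ * w) ^ 2 * (δ / μ) ^ 2 := by gcongr
    _ = δ ^ 2 * ((j : ℕ) / L) := by rw [mul_pow, hw2]; field_simp
    _ ≤ _ := by gcongr

section Operator

variable {H : Type*} [NormedAddCommGroup H] [InnerProductSpace ℝ H] [CompleteSpace H]

lemma hasSum_inner_sq {ψ : ℕ → H} (hON : Orthonormal ℝ ψ)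
    (hdense : (Submodule.span ℝ (Set.range ψ)).topologicalClosure = ⊤) (z : H) :
    HasSum (fun n => (inner ℝ (ψ n) z : ℝ) ^ 2) (‖z‖ ^ 2) := by
  have h := (HilbertBasis.mk hON hdense.ge).hasSum_inner_mul_inner z z
  rw [real_inner_self_eq_norm_sq, HilbertBasis.coe_mk] at h
  have hsq : (fun n => (inner ℝ (ψ n) z : ℝ) ^ 2) = fun n => inner ℝ z (ψ n) * inner ℝ (ψ n) z := by
    funext n
    rw [real_inner_comm (ψ n) z, sq]
  rw [hsq]
  exact h

lemma sum_range_mul_eq {K m : ℕ} (f : ℕ → ℝ) :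
    ∑ n ∈ Finset.range (K * m), f n =
      ∑ k : Fin K, ∑ i : Fin m, f (finProdFinEquiv (k, i)) := by
  rw [← Fin.sum_univ_eq_sum_range, ← finProdFinEquiv.sum_comp, Fintype.sum_prod_type]

/-- Covering the image of the unit ball under a positive operator with eigenvalues `lam`, of which
those with index at least `K * m` are at most `δ`. -/
lemma exists_cover_image_closedBall {T : H →L[ℝ] H} (hT : T.IsPositive)
    {ψ : ℕ → H} (hON : Orthonormal ℝ ψ)
    (hdense : (Submodule.span ℝ (Set.range ψ)).topologicalClosure = ⊤)
    {lam : ℕ → ℝ} (heig : ∀ n, T (ψ n) = lam n • ψ n) (hpos : ∀ n, 0 < lam n)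
    (hanti : Antitone lam) {m K L : ℕ} (hm : 0 < m) (hL : 0 < L) {δ : ℝ} (hδ : 0 < δ)
    (hhead : ∀ k < K, δ ≤ lam (k * m)) (htail : ∀ n, K * m ≤ n → lam n ≤ δ) :
    ∃ s : Finset H, (s.card : ℝ) ≤
        (L + 1) ^ K * ∏ k ∈ Finset.range K, (241 * (m + 1) ^ 5 * (lam (k * m) / δ) ^ (m + 2)) ∧
      ∀ x ∈ closure (T '' Metric.closedBall 0 1), ∃ y ∈ s, dist x y ≤ δ * √(1 + K / L) := by
  classical
  have hC : ∀ k : Fin K, ∃ C : Finset (EuclideanSpace ℝ (Fin m)),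
      (C.card : ℝ) ≤ 241 * (m + 1) ^ 5 * (lam (k * m) / δ) ^ (m + 2) ∧
      ∀ x : EuclideanSpace ℝ (Fin m), ‖x‖ ≤ 1 → ∃ c ∈ C, dist x c ≤ δ / lam (k * m) := by
    intro k
    have hk := hpos (k * m)
    obtain ⟨C, h1, h2⟩ := exists_cover_unitBall hm (div_pos hδ hk)
      ((div_le_one hk).2 (hhead k k.2))
    refine ⟨C, h1.trans_eq ?_, h2⟩
    rw [← inv_div (lam (k * m)) δ, inv_pow, div_inv_eq_mul]
  choose C hCcard hCcov using hC
  let β : (Fin K → Fin (L + 1)) × (Fin K → EuclideanSpace ℝ (Fin m)) → Fin K × Fin m → ℝ :=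
    fun p q => lam (q.1 * m) * √((p.1 q.1 : ℕ) / L) * p.2 q.1 q.2
  let Y : (Fin K → Fin (L + 1)) × (Fin K → EuclideanSpace ℝ (Fin m)) → H :=
    fun p => ∑ n : Fin (K * m), β p (finProdFinEquiv.symm n) • ψ n
  have hYin : ∀ p (n : Fin (K * m)), inner ℝ (ψ n) (Y p) = β p (finProdFinEquiv.symm n) := by
    intro p n
    exact (hON.comp (fun n : Fin (K * m) => (n : ℕ)) Fin.val_injective).inner_right_fintype
      (fun n => β p (finProdFinEquiv.symm n)) n
  have hYout : ∀ p (n : ℕ), K * m ≤ n → inner ℝ (ψ n) (Y p) = (0 : ℝ) := by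
    intro p n hn
    simp only [Y, inner_sum, real_inner_smul_right]
    refine Finset.sum_eq_zero fun i _ => ?_
    rw [hON.2 (by have := i.2; omega), mul_zero]
  have hTin : ∀ u n, inner ℝ (ψ n) (T u) = lam n * inner ℝ (ψ n) u := by
    intro u n
    rw [← hT.inner_left_eq_inner_right, heig, real_inner_smul_left]
  refine ⟨(Finset.univ ×ˢ Fintype.piFinset C).image Y, ?_, ?_⟩
  · calc (((Finset.univ ×ˢ Fintype.piFinset C).image Y).card : ℝ)
        ≤ ((Finset.univ ×ˢ Fintype.piFinset C : Finset ((Fin K → Fin (L + 1)) × _)).card : ℝ) := by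
          exact_mod_cast Finset.card_image_le
      _ = (L + 1) ^ K * ∏ k : Fin K, ((C k).card : ℝ) := by
          simp [Finset.card_product, Fintype.card_piFinset]
      _ ≤ (L + 1) ^ K * ∏ k : Fin K, (241 * (m + 1) ^ 5 * (lam (k * m) / δ) ^ (m + 2)) := by
          gcongr with k
          exact hCcard k
      _ = _ := by
          rw [Fin.prod_univ_eq_prod_range
            (fun k => (241 * ((m : ℝ) + 1) ^ 5 * (lam (k * m) / δ) ^ (m + 2))) K]
  · have hclosed : IsClosed (⋃ y ∈ (Finset.univ ×ˢ Fintype.piFinset C).image Y,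
        Metric.closedBall y (δ * √(1 + K / L))) :=
      Set.Finite.isClosed_biUnion (Finset.finite_toSet _) fun _ _ => Metric.isClosed_closedBall
    have hsub := closure_minimal (s := T '' Metric.closedBall 0 1) ?_ hclosed
    · intro x hx
      obtain ⟨y, hy, hxy⟩ := Set.mem_iUnion₂.1 (hsub hx)
      exact ⟨y, hy, hxy⟩
    rintro _ ⟨u, hu, rfl⟩
    rw [mem_closedBall_zero_iff] at hu
    have hus := hasSum_inner_sq hON hdense u
    set a : ℕ → ℝ := fun n => inner ℝ (ψ n) u with ha
    have hsplit := hus.summable.sum_add_tsum_nat_add (K * m)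
    rw [hus.tsum_eq, sum_range_mul_eq] at hsplit
    have htl : 0 ≤ ∑' n, a (n + K * m) ^ 2 := tsum_nonneg fun n => sq_nonneg _
    have hu2 : ‖u‖ ^ 2 ≤ 1 := pow_le_one₀ (norm_nonneg u) hu
    have hblock : ∀ k : Fin K, ∃ j : Fin (L + 1), ∃ c ∈ C k,
        ∑ i : Fin m, (lam (finProdFinEquiv (k, i)) * a (finProdFinEquiv (k, i))
          - lam (k * m) * √((j : ℕ) / L) * c i) ^ 2
        ≤ δ ^ 2 * (∑ i : Fin m, a (finProdFinEquiv (k, i)) ^ 2 + 1 / L) := by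
      intro k
      refine exists_block_code hL hδ.le (hpos (k * m)) (hCcov k) _ _ (fun i => (hpos _).le)
        (fun i => hanti ?_) ?_
      · simp [finProdFinEquiv, mul_comm]
      · have := Finset.single_le_sum (f := fun k : Fin K =>
          ∑ i : Fin m, a (finProdFinEquiv (k, i)) ^ 2)
          (fun k _ => Finset.sum_nonneg fun i _ => sq_nonneg _) (Finset.mem_univ k)
        linarith
    choose j c hcC hjc using hblock
    refine Set.mem_biUnion (x := Y (j, c)) ?_ ?_
    · exact Finset.mem_coe.2 (Finset.mem_image_of_mem _ (by simpa using hcC))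
    rw [mem_closedBall_iff_norm]
    refine (sq_le_sq₀ (norm_nonneg _) (by positivity)).1 ?_
    rw [mul_pow, Real.sq_sqrt (by positivity)]
    have hzs := hasSum_inner_sq hON hdense (T u - Y (j, c))
    have hzsplit := hzs.summable.sum_add_tsum_nat_add (K * m)
    rw [hzs.tsum_eq, sum_range_mul_eq] at hzsplit
    rw [← hzsplit]
    have h1 : ∑ k : Fin K, ∑ i : Fin m,
        (inner ℝ (ψ (finProdFinEquiv (k, i))) (T u - Y (j, c)) : ℝ) ^ 2
        ≤ δ ^ 2 * (∑ k : Fin K, ∑ i : Fin m, a (finProdFinEquiv (k, i)) ^ 2 + K / L) := by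
      calc _ ≤ ∑ k : Fin K, δ ^ 2 * (∑ i : Fin m, a (finProdFinEquiv (k, i)) ^ 2 + 1 / L) := by
            refine Finset.sum_le_sum fun k _ => le_trans (le_of_eq ?_) (hjc k)
            refine Finset.sum_congr rfl fun i _ => ?_
            rw [inner_sub_right, hYin, hTin]
            simp [β, ha]
        _ = _ := by
            rw [← Finset.mul_sum, Finset.sum_add_distrib]
            simp; left; ring
    have h2 : ∑' n, (inner ℝ (ψ (n + K * m)) (T u - Y (j, c)) : ℝ) ^ 2
        ≤ δ ^ 2 * ∑' n, a (n + K * m) ^ 2 := by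
      rw [← tsum_mul_left]
      refine Summable.tsum_le_tsum (fun n => ?_) ((summable_nat_add_iff (K * m)).2 hzs.summable)
        (((summable_nat_add_iff (K * m)).2 hus.summable).mul_left _)
      rw [inner_sub_right, hYout _ _ (by omega), hTin, sub_zero, mul_pow]
      gcongr
      · exact (hpos _).le
      · exact htail _ (by omega)
    nlinarith [sq_nonneg δ]

end Operator

/-- Volume lower bound for the cardinality of a cover of the image of the unit ball. -/
lemma prod_le_card_mul_pow_of_cover {H : Type*} [NormedAddCommGroup H] [InnerProductSpace ℝ H]
    {T : H →L[ℝ] H} (hT : T.IsPositive)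
    {ψ : ℕ → H} (hON : Orthonormal ℝ ψ)
    {lam : ℕ → ℝ} (heig : ∀ n, T (ψ n) = lam n • ψ n) (hpos : ∀ n, 0 < lam n)
    {ε : ℝ} (hε : 0 ≤ ε) {s : Finset H}
    (hs : ∀ x ∈ T '' Metric.closedBall 0 1, ∃ y ∈ s, dist x y ≤ ε) (N : ℕ) :
    ∏ n ∈ Finset.range N, lam n ≤ s.card * ε ^ N := by
  have hONN : Orthonormal ℝ (fun i : Fin N => ψ i) := hON.comp _ Fin.val_injective
  let P : H → EuclideanSpace ℝ (Fin N) := fun z => WithLp.toLp 2 fun i => inner ℝ (ψ i) z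
  have hP : ∀ x y, dist (P x) (P y) ≤ dist x y := by
    intro x y
    rw [EuclideanSpace.dist_eq, Real.sqrt_le_left dist_nonneg, dist_eq_norm x y]
    simp only [P, Real.dist_eq, ← inner_sub_right, sq_abs]
    simpa using hONN.sum_inner_products_le (x - y) (s := Finset.univ)
  let b := (EuclideanSpace.basisFun (Fin N) ℝ).toBasis
  let D := Matrix.toLin b b (Matrix.diagonal fun i : Fin N => lam i)
  have hD : ∀ v i, D v i = lam i * v i := by
    intro v i
    have h : b.repr (D v) i = (Matrix.diagonal (fun i : Fin N => lam i)).mulVec (b.repr v) i := by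
      rw [← LinearMap.toMatrix_mulVec_repr b b D, LinearMap.toMatrix_toLin]
    simpa [b, Matrix.mulVec_diagonal] using h
  have hdet : D.det = ∏ n ∈ Finset.range N, lam n := by
    rw [LinearMap.det_toLin, Matrix.det_diagonal, Fin.prod_univ_eq_prod_range lam N]
  have hsub : D '' Metric.closedBall 0 1 ⊆ ⋃ y ∈ s, Metric.closedBall (P y) ε := by
    rintro _ ⟨v, hv, rfl⟩
    rw [mem_closedBall_zero_iff] at hv
    let u : H := ∑ i : Fin N, v i • ψ i
    have hu : ‖u‖ ≤ 1 := by
      have h2 : ‖u‖ ^ 2 = ‖v‖ ^ 2 := by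
        rw [← real_inner_self_eq_norm_sq, EuclideanSpace.norm_sq_eq, hONN.inner_sum]
        simp [sq]
      have : ‖u‖ = ‖v‖ := (sq_eq_sq₀ (norm_nonneg _) (norm_nonneg _)).1 h2
      rw [this]; exact hv
    obtain ⟨y, hy, hxy⟩ := hs (T u) ⟨u, by simpa using hu, rfl⟩
    refine Set.mem_biUnion (Finset.mem_coe.2 hy) ?_
    have hDv : D v = P (T u) := by
      ext i
      simp only [P]
      rw [hD, ← hT.inner_left_eq_inner_right, heig, real_inner_smul_left,
        hONN.inner_right_fintype (fun i => v i) i]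
    rw [hDv, Metric.mem_closedBall]
    exact (hP _ _).trans hxy
  have hvol := measure_mono (μ := (volume : Measure (EuclideanSpace ℝ (Fin N)))) hsub
  rw [Measure.addHaar_image_linearMap, hdet] at hvol
  have hvol2 := hvol.trans (measure_biUnion_finset_le s _)
  simp only [Measure.addHaar_closedBall _ _ hε, Measure.addHaar_closedBall _ _ zero_le_one,
    finrank_euclideanSpace_fin, one_pow, ENNReal.ofReal_one, one_mul, Finset.sum_const,
    nsmul_eq_mul] at hvol2
  rw [← mul_assoc, ENNReal.mul_le_mul_iff_left (Metric.measure_ball_pos _ _ one_pos).ne'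
    measure_ball_lt_top.ne, abs_of_pos (Finset.prod_pos fun n _ => hpos n),
    ← ENNReal.ofReal_natCast, ← ENNReal.ofReal_mul (by positivity),
    ENNReal.ofReal_le_ofReal_iff (by positivity)] at hvol2
  exact hvol2

lemma isLittleO_rpow_rpow_atTop {a b : ℝ} (hab : a < b) :
    (fun x : ℝ => x ^ a) =o[atTop] fun x : ℝ => x ^ b := by
  refine (isLittleO_iff_tendsto' ?_).2 ?_
  · filter_upwards [eventually_gt_atTop 0] with x hx h
    exact absurd h (Real.rpow_pos_of_pos hx b).ne'
  · refine (tendsto_rpow_neg_atTop (sub_pos.2 hab)).congr' ?_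
    filter_upwards [eventually_gt_atTop 0] with x hx
    rw [← Real.rpow_sub hx, neg_sub]

lemma rpow_succ_sub_rpow_div_sub_bounds {γ : ℝ} (hγ0 : 0 < γ) (hγ1 : γ ≤ 1) {n : ℕ} (hn : 0 < n) :
    0 ≤ (((n : ℝ) + 1) ^ γ - (n : ℝ) ^ γ) / γ - ((n : ℝ) + 1) ^ (γ - 1) ∧
    (((n : ℝ) + 1) ^ γ - (n : ℝ) ^ γ) / γ - ((n : ℝ) + 1) ^ (γ - 1) ≤
      ((n : ℝ) + 1) ^ (γ - 1) * (1 / n) := by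
  have hn' : (0 : ℝ) < n := by exact_mod_cast hn
  have hn1 : (0 : ℝ) < n + 1 := by positivity
  have e1 : ((n : ℝ) + 1) ^ γ = (n + 1) ^ (γ - 1) * (n + 1) := by
    rw [← Real.rpow_add_one hn1.ne', sub_add_cancel]
  have e2 : (n : ℝ) ^ γ = (n : ℝ) ^ (γ - 1) * n := by
    rw [← Real.rpow_add_one hn'.ne', sub_add_cancel]
  constructor
  · have h := rpow_one_add_le_one_add_mul_self (s := -(1 / ((n : ℝ) + 1)))
      (by rw [neg_le_neg_iff, div_le_one hn1]; linarith) hγ0.le hγ1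
    have e3 : 1 + -(1 / ((n : ℝ) + 1)) = n / (n + 1) := by field_simp; ring
    rw [e3, Real.div_rpow hn'.le hn1.le, div_le_iff₀ (by positivity), add_mul, one_mul] at h
    have e4 : γ * -(1 / ((n : ℝ) + 1)) * (n + 1) ^ γ = -γ * (n + 1) ^ (γ - 1) := by
      rw [e1]; field_simp
    rw [e4] at h
    rw [sub_nonneg, le_div_iff₀ hγ0]
    linarith
  · have h := rpow_one_add_le_one_add_mul_self (s := 1 / (n : ℝ))
      (by have : 0 < 1 / (n : ℝ) := by positivity
          linarith) hγ0.le hγ1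
    have h' := rpow_one_add_le_one_add_mul_self (s := 1 / (n : ℝ)) (p := 1 - γ)
      (by have : 0 < 1 / (n : ℝ) := by positivity
          linarith) (by linarith) (by linarith)
    have e3 : 1 + 1 / (n : ℝ) = (n + 1) / n := by field_simp
    rw [e3, Real.div_rpow hn1.le hn'.le, div_le_iff₀ (by positivity), add_mul, one_mul] at h h'
    have e4 : γ * (1 / (n : ℝ)) * (n : ℝ) ^ γ = γ * (n : ℝ) ^ (γ - 1) := by
      rw [e2]; field_simp
    rw [e4] at h
    have hA : (((n : ℝ) + 1) ^ γ - (n : ℝ) ^ γ) / γ ≤ (n : ℝ) ^ (γ - 1) := by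
      rw [div_le_iff₀ hγ0]; linarith
    have e5 : (n : ℝ) ^ (γ - 1) = ((n : ℝ) ^ (1 - γ))⁻¹ := by
      rw [← Real.rpow_neg hn'.le, neg_sub]
    have e6 : ((n : ℝ) + 1) ^ (γ - 1) = (((n : ℝ) + 1) ^ (1 - γ))⁻¹ := by
      rw [← Real.rpow_neg hn1.le, neg_sub]
    have hB : (n : ℝ) ^ (γ - 1) ≤ ((n : ℝ) + 1) ^ (γ - 1) * (1 + 1 / n) := by
      rw [e5, e6, inv_mul_eq_div, le_div_iff₀ (by positivity), inv_mul_le_iff₀ (by positivity)]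
      have h2 : (1 - γ) * (1 / (n : ℝ)) * (n : ℝ) ^ (1 - γ) ≤ 1 * (1 / n) * (n : ℝ) ^ (1 - γ) := by
        gcongr; linarith
      linarith
    linarith

lemma sum_range_rpow_le {γ : ℝ} (hγ0 : 0 < γ) (hγ1 : γ ≤ 1) (N : ℕ) :
    ∑ n ∈ Finset.range N, ((n : ℝ) + 1) ^ (γ - 1) ≤ 1 / γ * (N : ℝ) ^ γ := by
  induction N with
  | zero => simp [Real.zero_rpow hγ0.ne']
  | succ n ih =>
    rw [Finset.sum_range_succ]
    push_cast
    rcases Nat.eq_zero_or_pos n with rfl | hn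
    · simpa using (one_le_inv₀ hγ0).2 hγ1
    · have h := (rpow_succ_sub_rpow_div_sub_bounds hγ0 hγ1 hn).1
      have e : (((n : ℝ) + 1) ^ γ - (n : ℝ) ^ γ) / γ =
        1 / γ * ((n : ℝ) + 1) ^ γ - 1 / γ * (n : ℝ) ^ γ := by ring
      linarith

lemma tendsto_sum_range_rpow_atTop {γ : ℝ} (hγ0 : 0 < γ) :
    Tendsto (fun N => ∑ n ∈ Finset.range N, ((n : ℝ) + 1) ^ (γ - 1)) atTop atTop := by
  refine tendsto_atTop_mono (fun N => ?_) Real.tendsto_sum_range_one_div_nat_succ_atTop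
  refine Finset.sum_le_sum fun n _ => ?_
  rw [one_div, ← Real.rpow_neg_one]
  exact Real.rpow_le_rpow_of_exponent_le (by linarith [Nat.cast_nonneg (α := ℝ) n]) (by linarith)

lemma abs_mul_log_succ_sub_log_sub_one_le {n : ℕ} (hn : 0 < n) :
    |(n : ℝ) * (Real.log (n + 1) - Real.log n) - 1| ≤ 1 / n := by
  have hn' : (0 : ℝ) < n := by exact_mod_cast hn
  have hn1 : (0 : ℝ) < n + 1 := by positivity
  rw [← Real.log_div hn1.ne' hn'.ne', abs_le]
  have h1 := Real.log_le_sub_one_of_pos (x := ((n : ℝ) + 1) / n) (by positivity)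
  have h2 := Real.one_sub_inv_le_log_of_pos (x := ((n : ℝ) + 1) / n) (by positivity)
  have e1 : ((n : ℝ) + 1) / n - 1 = 1 / n := by field_simp; ring
  have e2 : 1 - (((n : ℝ) + 1) / n)⁻¹ = 1 / (n + 1) := by field_simp; ring
  rw [e1] at h1
  rw [e2] at h2
  have h3 : (n : ℝ) * (1 / n) = 1 := by field_simp
  have h4 : (n : ℝ) * (1 / (n + 1)) = 1 - 1 / (n + 1) := by field_simp; ring
  have h5 : 1 / ((n : ℝ) + 1) ≤ 1 / n := by gcongr; linarith
  have h6 : 0 < 1 / (n : ℝ) := by positivity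
  constructor
  · nlinarith [mul_le_mul_of_nonneg_left h2 hn'.le]
  · nlinarith [mul_le_mul_of_nonneg_left h1 hn'.le]

lemma log_one_add_sub_isLittleO : (fun t : ℝ => Real.log (1 + t) - t) =o[𝓝 0] fun t => t := by
  have h : HasDerivAt (fun t : ℝ => Real.log (1 + t)) 1 0 := by
    have := ((hasDerivAt_id (0 : ℝ)).const_add 1).log (by simp)
    simpa using this
  have := h.isLittleO
  simpa using this

/-- The logarithms of a sequence with second order power law asymptotics. -/
lemma log_sub_isLittleO {lam : ℕ → ℝ} (hpos : ∀ n, 0 < lam n) {c₁ c₂ α₁ α₂ : ℝ} (hc₁ : 0 < c₁)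
    (hcase : α₁ < α₂ ∨ (α₁ = α₂ ∧ c₂ = 0))
    (hasymp : (fun n : ℕ => lam n - c₁ * ((n : ℝ) + 1) ^ (-α₁) - c₂ * ((n : ℝ) + 1) ^ (-α₂))
      =o[atTop] fun n : ℕ => ((n : ℝ) + 1) ^ (-α₂)) :
    Tendsto (fun n : ℕ => lam n * ((n : ℝ) + 1) ^ α₁ / c₁) atTop (𝓝 1) ∧
    (fun n : ℕ => Real.log (lam n) - Real.log c₁ + α₁ * Real.log ((n : ℝ) + 1)
      - c₂ / c₁ * ((n : ℝ) + 1) ^ (α₁ - α₂)) =o[atTop] fun n : ℕ => ((n : ℝ) + 1) ^ (α₁ - α₂) := by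
  set t : ℕ → ℝ := fun n => lam n * ((n : ℝ) + 1) ^ α₁ / c₁ - 1 with ht
  have hn1 : ∀ n : ℕ, (0 : ℝ) < (n : ℝ) + 1 := fun n => by positivity
  have ht1 : (fun n => t n - c₂ / c₁ * ((n : ℝ) + 1) ^ (α₁ - α₂)) =o[atTop]
      fun n : ℕ => ((n : ℝ) + 1) ^ (α₁ - α₂) := by
    have h := ((hasymp.mul_isBigO (isBigO_refl (fun n : ℕ => ((n : ℝ) + 1) ^ α₁) atTop)).const_mul_left
      (1 / c₁))
    refine (h.congr_left fun n => ?_).congr_right fun n => ?_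
    · have e1 : ((n : ℝ) + 1) ^ (-α₁) * ((n : ℝ) + 1) ^ α₁ = 1 := by
        rw [← Real.rpow_add (hn1 n), neg_add_cancel, Real.rpow_zero]
      have e2 : ((n : ℝ) + 1) ^ (-α₂) * ((n : ℝ) + 1) ^ α₁ = ((n : ℝ) + 1) ^ (α₁ - α₂) := by
        rw [← Real.rpow_add (hn1 n)]; congr 1; ring
      rw [ht, ← e2]
      field_simp
      linear_combination (-c₁) * e1
    · rw [← Real.rpow_add (hn1 n)]; congr 1; ring
  have hcast : Tendsto (fun n : ℕ => (n : ℝ) + 1) atTop atTop :=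
    tendsto_atTop_add_const_right _ _ tendsto_natCast_atTop_atTop
  have ht0 : Tendsto t atTop (𝓝 0) := by
    have hb : Tendsto (fun n : ℕ => c₂ / c₁ * ((n : ℝ) + 1) ^ (α₁ - α₂)) atTop (𝓝 0) := by
      rcases hcase with h | ⟨_, h⟩
      · have := ((tendsto_rpow_neg_atTop (sub_pos.2 h)).comp hcast).const_mul (c₂ / c₁)
        simpa [Function.comp_def] using this
      · simp [h]
    have hle : (fun n : ℕ => ((n : ℝ) + 1) ^ (α₁ - α₂)) =O[atTop] fun _ => (1 : ℝ) := by
      refine IsBigO.of_bound 1 (Eventually.of_forall fun n => ?_)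
      rw [Real.norm_of_nonneg (Real.rpow_nonneg (hn1 n).le _)]
      simp only [norm_one, mul_one]
      refine Real.rpow_le_one_of_one_le_of_nonpos (by linarith [Nat.cast_nonneg (α := ℝ) n]) ?_
      rcases hcase with h | ⟨h, _⟩ <;> linarith
    have := (isLittleO_one_iff ℝ).1 (ht1.trans_isBigO hle)
    simpa using this.add hb
  refine ⟨by simpa [ht] using ht0.add_const 1, ?_⟩
  have htO : t =O[atTop] fun n : ℕ => ((n : ℝ) + 1) ^ (α₁ - α₂) := by
    have := ht1.isBigO.add ((isBigO_refl (fun n : ℕ => ((n : ℝ) + 1) ^ (α₁ - α₂)) atTop).const_mul_left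
      (c₂ / c₁))
    simpa using this
  have hlog := (log_one_add_sub_isLittleO.comp_tendsto ht0).trans_isBigO htO
  refine (hlog.add ht1).congr_left fun n => ?_
  have e : 1 + t n = lam n * ((n : ℝ) + 1) ^ α₁ / c₁ := by simp [ht]
  have hp := Real.rpow_pos_of_pos (hn1 n) α₁
  simp only [Function.comp_apply]
  rw [e, Real.log_div (mul_pos (hpos n) hp).ne' hc₁.ne', Real.log_mul (hpos n).ne' hp.ne',
    Real.log_rpow (hn1 n)]
  ring

/-- Partial sums of the logarithms of a sequence with second order power law asymptotics. -/
lemma sum_log_sub_isLittleO {lam : ℕ → ℝ} {c₁ b α γ : ℝ} (hγ0 : 0 < γ) (hγ1 : γ ≤ 1)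
    (h : (fun n : ℕ => Real.log (lam n) - Real.log c₁ + α * Real.log ((n : ℝ) + 1)
      - b * ((n : ℝ) + 1) ^ (γ - 1)) =o[atTop] fun n : ℕ => ((n : ℝ) + 1) ^ (γ - 1)) :
    (fun N : ℕ => ∑ n ∈ Finset.range N, Real.log (lam n)
      - (N * Real.log c₁ - α * (N * Real.log N - N) + b / γ * (N : ℝ) ^ γ))
      =o[atTop] fun N : ℕ => (N : ℝ) ^ γ := by
  have hn1 : ∀ n : ℕ, (0 : ℝ) < (n : ℝ) + 1 := fun n => by positivity
  have hinv : Tendsto (fun n : ℕ => 1 / (n : ℝ)) atTop (𝓝 0) := tendsto_one_div_atTop_nhds_zero_nat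
  have hsmall : (fun n : ℕ => ((n : ℝ) + 1) ^ (γ - 1) * (1 / n)) =o[atTop]
      fun n : ℕ => ((n : ℝ) + 1) ^ (γ - 1) := by
    have := (isBigO_refl (fun n : ℕ => ((n : ℝ) + 1) ^ (γ - 1)) atTop).mul_isLittleO
      ((isLittleO_one_iff ℝ).2 hinv)
    simpa using this
  have h2 : (fun n : ℕ => (n : ℝ) * (Real.log (n + 1) - Real.log n) - 1) =o[atTop]
      fun n : ℕ => ((n : ℝ) + 1) ^ (γ - 1) := by
    have hO : (fun n : ℕ => (n : ℝ) * (Real.log (n + 1) - Real.log n) - 1) =O[atTop]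
        fun n : ℕ => ((n : ℝ) + 1) ^ (-1 : ℝ) := by
      refine IsBigO.of_bound 2 ?_
      filter_upwards [eventually_gt_atTop 0] with n hn
      have hn' : (1 : ℝ) ≤ n := by exact_mod_cast hn
      rw [Real.norm_eq_abs, Real.norm_of_nonneg (by positivity), Real.rpow_neg_one]
      refine (abs_mul_log_succ_sub_log_sub_one_le hn).trans ?_
      rw [← div_eq_mul_inv, div_le_div_iff₀ (by positivity) (by positivity)]
      linarith
    refine hO.trans_isLittleO ?_
    have hcast : Tendsto (fun n : ℕ => (n : ℝ) + 1) atTop atTop :=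
      tendsto_atTop_add_const_right _ _ tendsto_natCast_atTop_atTop
    exact (isLittleO_rpow_rpow_atTop (by linarith : (-1 : ℝ) < γ - 1)).comp_tendsto hcast
  have h3 : (fun n : ℕ => (((n : ℝ) + 1) ^ γ - (n : ℝ) ^ γ) / γ - ((n : ℝ) + 1) ^ (γ - 1)) =o[atTop]
      fun n : ℕ => ((n : ℝ) + 1) ^ (γ - 1) := by
    refine IsBigO.trans_isLittleO (IsBigO.of_bound 1 ?_) hsmall
    filter_upwards [eventually_gt_atTop 0] with n hn
    obtain ⟨ha, hb⟩ := rpow_succ_sub_rpow_div_sub_bounds hγ0 hγ1 hn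
    rw [Real.norm_of_nonneg ha, Real.norm_of_nonneg (ha.trans hb), one_mul]
    exact hb
  have htot := (h.add (h2.const_mul_left α)).sub (h3.const_mul_left b)
  have hsum := (htot.sum_range (fun n => (Real.rpow_pos_of_pos (hn1 n) _).le)
    (tendsto_sum_range_rpow_atTop hγ0))
  have hO : (fun N : ℕ => ∑ n ∈ Finset.range N, ((n : ℝ) + 1) ^ (γ - 1)) =O[atTop]
      fun N : ℕ => (N : ℝ) ^ γ := by
    refine IsBigO.of_bound (1 / γ) (Eventually.of_forall fun N => ?_)
    rw [Real.norm_of_nonneg (Finset.sum_nonneg fun n _ => (Real.rpow_pos_of_pos (hn1 n) _).le),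
      Real.norm_of_nonneg (by positivity)]
    exact sum_range_rpow_le hγ0 hγ1 N
  refine (hsum.trans_isBigO hO).congr_left fun N => ?_
  induction N with
  | zero => simp [Real.zero_rpow hγ0.ne']
  | succ N ih =>
    rw [Finset.sum_range_succ, ih, Finset.sum_range_succ]
    push_cast
    ring

lemma coveringNumber_le_card {X : Type*} [PseudoMetricSpace X] {ε : ℝ} {K : Set X} {s : Finset X}
    (hs : ∀ x ∈ K, ∃ y ∈ s, dist x y ≤ ε) : coveringNumber ε K ≤ s.card :=
  Nat.sInf_le ⟨s, rfl, hs⟩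

lemma exists_cover_card_eq_coveringNumber {X : Type*} [PseudoMetricSpace X] {ε : ℝ} (hε : 0 < ε)
    {K : Set X} (hK : TotallyBounded K) :
    ∃ s : Finset X, s.card = coveringNumber ε K ∧ ∀ x ∈ K, ∃ y ∈ s, dist x y ≤ ε := by
  obtain ⟨t, ht, hcov⟩ := Metric.totallyBounded_iff.1 hK ε hε
  refine Nat.sInf_mem (s := {n | ∃ s : Finset X, s.card = n ∧ ∀ x ∈ K, ∃ y ∈ s, dist x y ≤ ε})
    ⟨ht.toFinset.card, ht.toFinset, rfl, fun x hx => ?_⟩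
  obtain ⟨y, hy, hxy⟩ := Set.mem_iUnion₂.1 (hcov hx)
  exact ⟨y, by simpa using hy, (Metric.mem_ball.1 hxy).le⟩

lemma sum_log_le_log_coveringNumber {H : Type*} [NormedAddCommGroup H] [InnerProductSpace ℝ H]
    {T : H →L[ℝ] H} (hcomp : IsCompactOperator T)
    (hT : T.IsPositive) {ψ : ℕ → H} (hON : Orthonormal ℝ ψ)
    {lam : ℕ → ℝ} (heig : ∀ n, T (ψ n) = lam n • ψ n) (hpos : ∀ n, 0 < lam n)
    {ε : ℝ} (hε : 0 < ε) (N : ℕ) :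
    ∑ n ∈ Finset.range N, Real.log (lam n) - N * Real.log ε ≤
      Real.log (coveringNumber ε (closure (T '' Metric.closedBall 0 1))) := by
  have hK : TotallyBounded (closure (T '' Metric.closedBall 0 1)) :=
    (IsCompactOperator.isCompact_closure_image_closedBall (f := (T : H →ₗ[ℝ] H)) hcomp 1).totallyBounded
  obtain ⟨s, hs, hcov⟩ := exists_cover_card_eq_coveringNumber hε hK
  have h := prod_le_card_mul_pow_of_cover hT hON heig hpos hε.le
    (fun x hx => hcov x (subset_closure hx)) N
  have hprod : 0 < ∏ n ∈ Finset.range N, lam n := Finset.prod_pos fun n _ => hpos n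
  have hεN : 0 < ε ^ N := pow_pos hε N
  have hcard : (0 : ℝ) < s.card := by
    by_contra! h0
    nlinarith
  rw [← hs, sub_le_iff_le_add, ← Real.log_prod fun n _ => (hpos n).ne', ← Real.log_pow,
    ← Real.log_mul hcard.ne' hεN.ne']
  exact Real.log_le_log hprod h

lemma log_coveringNumber_le {H : Type*} [NormedAddCommGroup H] [InnerProductSpace ℝ H]
    [CompleteSpace H] {T : H →L[ℝ] H} (hT : T.IsPositive)
    {ψ : ℕ → H} (hON : Orthonormal ℝ ψ)
    (hdense : (Submodule.span ℝ (Set.range ψ)).topologicalClosure = ⊤)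
    {lam : ℕ → ℝ} (heig : ∀ n, T (ψ n) = lam n • ψ n) (hpos : ∀ n, 0 < lam n)
    (hanti : Antitone lam) {d m M : ℕ} (hd : 0 < d) (hm : 0 < m) (hM : 0 < M) {δ : ℝ} (hδ : 0 < δ)
    (hhead : ∀ n < d, δ < lam n) (htail : ∀ n, d ≤ n → lam n ≤ δ) :
    Real.log (coveringNumber (δ * √(1 + 1 / M)) (closure (T '' Metric.closedBall 0 1))) ≤
      (∑ n ∈ Finset.range d, Real.log (lam n) - d * Real.log δ)
      + (m + 2 * (d / m + 1)) * (Real.log (lam 0) - Real.log δ)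
      + (d / m + 1) * (Real.log (d * M + 1) + Real.log 241 + 5 * Real.log (m + 1)) := by
  have hm' : (0 : ℝ) < m := by exact_mod_cast hm
  obtain ⟨K, hK⟩ : ∃ K, (d + m - 1) / m = K + 1 :=
    Nat.exists_eq_succ_of_ne_zero (Nat.div_pos (by omega) hm).ne'
  have hKd : K * m < d := by
    have := Nat.div_mul_le_self (d + m - 1) m
    rw [hK, Nat.succ_mul] at this
    omega
  have hdK : d ≤ (K + 1) * m := by
    have := Nat.lt_div_mul_add (a := d + m - 1) hm
    rw [hK] at this
    omega
  have hKled : K + 1 ≤ d := by nlinarith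
  have hKr : (K : ℝ) + 1 ≤ d / m + 1 := by
    have : (K : ℝ) * m ≤ d := by exact_mod_cast hKd.le
    rw [add_le_add_iff_right, le_div_iff₀ hm']; exact this
  obtain ⟨s, hcard, hcov⟩ := exists_cover_image_closedBall hT hON hdense heig hpos hanti
    (K := K + 1) (L := (K + 1) * M) hm (by positivity) hδ
    (fun k hk => (hhead _ (lt_of_le_of_lt (Nat.mul_le_mul_right m (Nat.lt_succ_iff.1 hk)) hKd)).le)
    (fun n hn => htail n (hdK.trans hn))
  have hM' : (0 : ℝ) < M := by exact_mod_cast hM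
  have heq : (((K + 1 : ℕ) : ℝ) / (((K + 1) * M : ℕ) : ℝ)) = 1 / M := by
    push_cast; field_simp
  rw [heq] at hcov
  have hq : ∀ n, 0 < lam n / δ := fun n => div_pos (hpos n) hδ
  set a : ℕ → ℝ := fun n => Real.log (lam n) - Real.log δ with ha
  have halog : ∀ n, Real.log (lam n / δ) = a n := fun n => Real.log_div (hpos n).ne' hδ.ne'
  have haanti : Antitone a := fun i j hij => by
    have := Real.log_le_log (hpos j) (hanti hij)
    simp only [ha]; linarith
  have ha0 : ∀ n < d, 0 ≤ a n := fun n hn => by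
    have := Real.log_le_log hδ (hhead n hn).le
    simp only [ha]; linarith
  have h0 : 0 ≤ a 0 := ha0 0 hd
  have hsumd : ∑ n ∈ Finset.range d, a n = ∑ n ∈ Finset.range d, Real.log (lam n) - d * Real.log δ := by
    simp [ha, Finset.sum_sub_distrib]
  have hblock : ∀ J, J * m < d → ∑ k ∈ Finset.range (J + 1), m * a (k * m) ≤
      m * a 0 + ∑ n ∈ Finset.range (J * m), a n := by
    intro J
    induction J with
    | zero => simp
    | succ J ih =>
      intro hJ
      have hJ' : J * m < d := lt_of_le_of_lt (Nat.mul_le_mul_right m J.le_succ) hJ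
      rw [Finset.sum_range_succ, Nat.succ_mul, Finset.sum_range_add a (J * m) m]
      have : (m : ℝ) * a (J * m + m) ≤ ∑ i ∈ Finset.range m, a (J * m + i) := by
        have := Finset.card_nsmul_le_sum (Finset.range m) (fun i => a (J * m + i)) (a (J * m + m))
          (fun i hi => haanti (by have := Finset.mem_range.1 hi; omega))
        simpa using this
      linarith [ih hJ']
  have hsumle : ∑ n ∈ Finset.range (K * m), a n ≤ ∑ n ∈ Finset.range d, a n :=
    Finset.sum_le_sum_of_subset_of_nonneg (Finset.range_subset_range.2 hKd.le)
      fun n hn _ => ha0 n (Finset.mem_range.1 hn)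
  have hsum2 : ∑ k ∈ Finset.range (K + 1), a (k * m) ≤ (K + 1) * a 0 := by
    have := Finset.sum_le_card_nsmul (Finset.range (K + 1)) (fun k => a (k * m)) (a 0)
      (fun k _ => haanti (Nat.zero_le _))
    simpa using this
  set N := coveringNumber (δ * √(1 + 1 / M)) (closure (T '' Metric.closedBall 0 1)) with hN
  have hNs : (N : ℝ) ≤ s.card := by exact_mod_cast coveringNumber_le_card hcov
  have hlogm : 0 ≤ Real.log (m + 1) := Real.log_nonneg (by linarith)
  have hlog241 : 0 ≤ Real.log 241 := Real.log_nonneg (by norm_num)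
  have hL : Real.log ((((K + 1) * M : ℕ) : ℝ) + 1) ≤ Real.log (d * M + 1) := by
    apply Real.log_le_log (by positivity)
    have : (((K + 1) * M : ℕ) : ℝ) ≤ (d * M : ℕ) := by exact_mod_cast Nat.mul_le_mul_right M hKled
    push_cast at this ⊢
    linarith
  have hL0 : 0 ≤ Real.log ((((K + 1) * M : ℕ) : ℝ) + 1) :=
    Real.log_nonneg (by linarith [Nat.cast_nonneg (α := ℝ) ((K + 1) * M)])
  have hlogB : Real.log (((((K + 1) * M : ℕ) : ℝ) + 1) ^ (K + 1) *
      ∏ k ∈ Finset.range (K + 1), (241 * ((m : ℝ) + 1) ^ 5 * (lam (k * m) / δ) ^ (m + 2))) =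
      (K + 1) * (Real.log ((((K + 1) * M : ℕ) : ℝ) + 1) + Real.log 241 + 5 * Real.log (m + 1))
      + (∑ k ∈ Finset.range (K + 1), m * a (k * m) + 2 * ∑ k ∈ Finset.range (K + 1), a (k * m)) := by
    have hterm : ∀ k, 0 < 241 * ((m : ℝ) + 1) ^ 5 * (lam (k * m) / δ) ^ (m + 2) := fun k => by
      have := hq (k * m)
      positivity
    have hlogk : ∀ k, Real.log (241 * ((m : ℝ) + 1) ^ 5 * (lam (k * m) / δ) ^ (m + 2)) =
        (Real.log 241 + 5 * Real.log (m + 1)) + (m * a (k * m) + 2 * a (k * m)) := fun k => by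
      rw [Real.log_mul (by positivity) (pow_pos (hq _) _).ne', Real.log_mul (by norm_num) (by positivity),
        Real.log_pow, Real.log_pow, halog]
      push_cast
      ring
    rw [Real.log_mul (by positivity) (Finset.prod_pos fun k _ => hterm k).ne', Real.log_pow,
      Real.log_prod fun k _ => (hterm k).ne']
    simp only [hlogk, Finset.sum_add_distrib, Finset.sum_const, Finset.card_range, nsmul_eq_mul,
      ← Finset.mul_sum]
    push_cast
    ring
  have hlogN : Real.log N ≤ (K + 1) * (Real.log ((((K + 1) * M : ℕ) : ℝ) + 1) + Real.log 241
      + 5 * Real.log (m + 1))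
      + (∑ k ∈ Finset.range (K + 1), m * a (k * m) + 2 * ∑ k ∈ Finset.range (K + 1), a (k * m)) := by
    rw [← hlogB]
    rcases Nat.eq_zero_or_pos N with h | h
    · rw [h, Nat.cast_zero, Real.log_zero, hlogB]
      have h1 : 0 ≤ ∑ k ∈ Finset.range (K + 1), a (k * m) := Finset.sum_nonneg fun k hk =>
        ha0 _ (lt_of_le_of_lt (Nat.mul_le_mul_right m (Nat.lt_succ_iff.1 (Finset.mem_range.1 hk))) hKd)
      rw [← Finset.mul_sum]
      positivity
    · exact Real.log_le_log (by exact_mod_cast h) (hNs.trans hcard)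
  have hfin1 : (K + 1) * (Real.log ((((K + 1) * M : ℕ) : ℝ) + 1) + Real.log 241 + 5 * Real.log (m + 1))
      ≤ (d / m + 1) * (Real.log (d * M + 1) + Real.log 241 + 5 * Real.log (m + 1)) := by
    gcongr
  have hfin2 : ((K : ℝ) + 1) * a 0 ≤ (d / m + 1) * a 0 := by gcongr
  have := hblock K hKd
  rw [← hsumd]
  change Real.log N ≤ _ + (m + 2 * (d / m + 1)) * a 0 + _
  linarith

lemma exists_counting_index {lam : ℕ → ℝ} (hanti : Antitone lam) (h0 : Tendsto lam atTop (𝓝 0))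
    {δ : ℝ} (hδ : 0 < δ) : ∃ d, (∀ n < d, δ < lam n) ∧ ∀ n, d ≤ n → lam n ≤ δ := by
  classical
  have hex : ∃ n, lam n ≤ δ := (h0.eventually_le_const hδ).exists
  exact ⟨Nat.find hex, fun n hn => not_le.1 (Nat.find_min hex hn),
    fun n hn => (hanti hn).trans (Nat.find_spec hex)⟩

/-- First order asymptotics of the counting function of a sequence obeying a power law. -/
lemma tendsto_counting_mul_rpow {lam : ℕ → ℝ} (hpos : ∀ n, 0 < lam n) {c α : ℝ}
    (hc : 0 < c) (hα : 0 < α)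
    (h : Tendsto (fun n : ℕ => lam n * ((n : ℝ) + 1) ^ α / c) atTop (𝓝 1)) {D : ℝ → ℕ}
    (hD : ∀ δ, 0 < δ → (∀ n < D δ, δ < lam n) ∧ ∀ n, D δ ≤ n → lam n ≤ δ) :
    Tendsto (fun δ => D δ * (δ / c) ^ (1 / α)) (𝓝[>] 0) (𝓝 1) := by
  have hinv : 0 < 1 / α := by positivity
  have hDtop : Tendsto D (𝓝[>] 0) atTop := by
    refine tendsto_atTop.2 fun K => ?_
    filter_upwards [Ioo_mem_nhdsGT (hpos K)] with δ hδ
    by_contra! hK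
    exact absurd ((hD δ hδ.1).2 K hK.le) (not_le.2 hδ.2)
  have hr : Tendsto (fun n : ℕ => ((n : ℝ) + 1) * (lam n / c) ^ (1 / α)) atTop (𝓝 1) := by
    have := h.rpow_const (p := 1 / α) (Or.inl one_ne_zero)
    rw [Real.one_rpow] at this
    refine this.congr fun n => ?_
    have hn : (0 : ℝ) ≤ (n : ℝ) + 1 := by positivity
    rw [mul_comm, mul_div_assoc, Real.mul_rpow (by positivity) (div_pos (hpos n) hc).le,
      ← Real.rpow_mul hn, mul_one_div_cancel hα.ne', Real.rpow_one]
  have hx : Tendsto (fun δ : ℝ => (δ / c) ^ (1 / α)) (𝓝[>] 0) (𝓝 0) := by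
    have h1 : Tendsto (fun δ : ℝ => δ / c) (𝓝[>] 0) (𝓝 0) := by
      have : Tendsto (fun δ : ℝ => δ / c) (𝓝 0) (𝓝 (0 / c)) := tendsto_id.div_const c
      rw [zero_div] at this
      exact this.mono_left nhdsWithin_le_nhds
    have := h1.rpow_const (p := 1 / α) (Or.inr hinv.le)
    rwa [Real.zero_rpow hinv.ne'] at this
  have hlow : Tendsto (fun δ => ((D δ : ℝ) + 1) * (lam (D δ) / c) ^ (1 / α) - (δ / c) ^ (1 / α))
      (𝓝[>] 0) (𝓝 1) := by
    simpa using (hr.comp hDtop).sub hx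
  have hup := hr.comp ((tendsto_sub_atTop_nat 1).comp hDtop)
  refine tendsto_of_tendsto_of_tendsto_of_le_of_le' hlow hup ?_ ?_
  · filter_upwards [self_mem_nhdsWithin] with δ hδ
    have hle : (lam (D δ) / c) ^ (1 / α) ≤ (δ / c) ^ (1 / α) := by
      have := (hpos (D δ)).le
      have := (hD δ hδ).2 _ le_rfl
      gcongr
    have : (0 : ℝ) ≤ (D δ : ℝ) + 1 := by positivity
    nlinarith
  · filter_upwards [self_mem_nhdsWithin, hDtop.eventually_ge_atTop 1] with δ hδ h1
    have hδ0 : (0 : ℝ) < δ := hδ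
    have hle : (δ / c) ^ (1 / α) ≤ (lam (D δ - 1) / c) ^ (1 / α) := by
      have := (hD δ hδ).1 (D δ - 1) (by omega)
      gcongr
    simp only [Function.comp_apply]
    rw [Nat.cast_sub h1, Nat.cast_one, sub_add_cancel]
    gcongr

lemma isLittleO_rpow_of_tendsto_div {ι : Type*} {l : Filter ι} {γ : ℝ} (a : ℝ)
    {s : ℕ → ℝ} (hs : s =o[atTop] fun N : ℕ => (N : ℝ) ^ γ) {y : ι → ℝ} (hy : Tendsto y l atTop)
    {n : ι → ℕ} (hn : Tendsto (fun i => n i / y i) l (𝓝 1)) :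
    (fun i => a * ((n i : ℝ) ^ γ - y i ^ γ) + s (n i)) =o[l] fun i => y i ^ γ := by
  have hntop : Tendsto n l atTop := by
    refine tendsto_natCast_atTop_iff (R := ℝ).1 ?_
    refine (hn.pos_mul_atTop one_pos hy).congr' ?_
    filter_upwards [hy.eventually_gt_atTop 0] with i hi
    field_simp
  have hratio : Tendsto (fun i => (n i / y i) ^ γ) l (𝓝 1) := by
    simpa using hn.rpow_const (p := γ) (Or.inl one_ne_zero)
  have heq : (fun i => (n i / y i) ^ γ * y i ^ γ) =ᶠ[l] fun i => (n i : ℝ) ^ γ := by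
    filter_upwards [hy.eventually_gt_atTop 0] with i hi
    rw [Real.div_rpow (Nat.cast_nonneg _) hi.le, div_mul_cancel₀ _ (Real.rpow_pos_of_pos hi γ).ne']
  have hO : (fun i => (n i : ℝ) ^ γ) =O[l] fun i => y i ^ γ := by
    have := (hratio.isBigO_one ℝ).mul (isBigO_refl (fun i => y i ^ γ) l)
    simpa using this.congr' heq EventuallyEq.rfl
  have hdiff : (fun i => (n i : ℝ) ^ γ - y i ^ γ) =o[l] fun i => y i ^ γ := by
    have h1 : Tendsto (fun i => (n i / y i) ^ γ - 1) l (𝓝 0) := by simpa using hratio.sub_const 1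
    have := ((isLittleO_one_iff ℝ).2 h1).mul_isBigO (isBigO_refl (fun i => y i ^ γ) l)
    refine (this.congr' ?_ EventuallyEq.rfl).congr_right fun i => one_mul _
    filter_upwards [heq] with i hi
    rw [sub_mul, hi, one_mul]
  exact (hdiff.const_mul_left a).add ((hs.comp_tendsto hntop).trans_isBigO hO)

lemma mul_log_sub_mul_log_add_le {y t : ℝ} (hy : 0 < y) (ht : 0 ≤ t) :
    t * Real.log y - t * Real.log t + t ≤ y := by
  rcases ht.eq_or_lt with rfl | ht
  · simpa using hy.le
  · have h := Real.log_le_sub_one_of_pos (div_pos hy ht)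
    rw [Real.log_div hy.ne' ht.ne'] at h
    have h2 := mul_le_mul_of_nonneg_left h ht.le
    have e : t * (y / t - 1) = y - t := by field_simp
    linarith

lemma sub_one_le_mul_log_floor {y : ℝ} (hy : 1 ≤ y) :
    y - 1 ≤ ⌊y⌋₊ * Real.log y - ⌊y⌋₊ * Real.log ⌊y⌋₊ + ⌊y⌋₊ := by
  have h1 : (1 : ℝ) ≤ ⌊y⌋₊ := by exact_mod_cast (Nat.one_le_floor_iff y).2 hy
  have h2 : Real.log ⌊y⌋₊ ≤ Real.log y := Real.log_le_log (by linarith) (Nat.floor_le (by linarith))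
  have h3 := (Nat.lt_floor_add_one y).le
  nlinarith

lemma block_overhead_le {y A B : ℝ} (hy : 241 ≤ y) {d m M : ℕ} (hd : d ≤ 2 * y) (hm : √y ≤ m)
    (hm' : m ≤ 2 * √y) (hM : M ≤ 2 * y) (hA : 0 ≤ A) (hB : B ≤ A * Real.log y) :
    (m + 2 * (d / m + 1)) * B
      + (d / m + 1) * (Real.log (d * M + 1) + Real.log 241 + 5 * Real.log (m + 1))
      ≤ (8 * A + 27) * (√y * Real.log y) := by
  have hy0 : 0 < y := by linarith
  have hs : √y * √y = y := Real.mul_self_sqrt hy0.le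
  have hs1 : 15 ≤ √y := Real.le_sqrt_of_sq_le (by linarith)
  have hm0 : (0 : ℝ) < m := by linarith
  have hdm : (d : ℝ) / m + 1 ≤ 3 * √y := by
    have : (d : ℝ) / m ≤ 2 * √y := by
      rw [div_le_iff₀ hm0]
      nlinarith
    linarith
  have hlog : 0 ≤ Real.log y := Real.log_nonneg (by linarith)
  have hl1 : Real.log (d * M + 1) ≤ 3 * Real.log y := by
    rw [show (3 : ℝ) * Real.log y = ((3 : ℕ) : ℝ) * Real.log y by norm_num, ← Real.log_pow]
    refine Real.log_le_log (by positivity) ?_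
    have : (d : ℝ) * M ≤ 2 * y * (2 * y) := by gcongr
    nlinarith [mul_pos hy0 hy0]
  have hl2 : Real.log 241 ≤ Real.log y := Real.log_le_log (by norm_num) hy
  have hl3 : Real.log (m + 1) ≤ Real.log y := Real.log_le_log (by positivity) (by nlinarith)
  have h1 : (m + 2 * ((d : ℝ) / m + 1)) * B ≤ (8 * √y) * (A * Real.log y) :=
    (mul_le_mul_of_nonneg_left hB (by positivity)).trans
      (mul_le_mul_of_nonneg_right (by linarith) (by positivity))
  have h2 : ((d : ℝ) / m + 1) * (Real.log (d * M + 1) + Real.log 241 + 5 * Real.log (m + 1)) ≤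
      (3 * √y) * (9 * Real.log y) :=
    (mul_le_mul_of_nonneg_left (by linarith) (by positivity)).trans
      (mul_le_mul_of_nonneg_right hdm (by positivity))
  linarith

lemma isLittleO_of_eventually_le_le {ι : Type*} {l : Filter ι} {f g u v : ι → ℝ}
    (hu : u =o[l] g) (hv : v =o[l] g) (h₁ : ∀ᶠ i in l, u i ≤ f i) (h₂ : ∀ᶠ i in l, f i ≤ v i) :
    f =o[l] g := by
  refine IsBigO.trans_isLittleO (g := fun i => |u i| + |v i|) ?_ (hu.abs_left.add hv.abs_left)
  refine IsBigO.of_bound 1 ?_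
  filter_upwards [h₁, h₂] with i hi₁ hi₂
  rw [one_mul, Real.norm_eq_abs, Real.norm_eq_abs, abs_of_nonneg (by positivity : 0 ≤ |u i| + |v i|),
    abs_le]
  constructor <;>
    linarith [neg_abs_le (u i), le_abs_self (v i), abs_nonneg (u i), abs_nonneg (v i)]

/-- Second order asymptotics of the logarithm of the covering numbers in the variable
`(c₁ / ε) ^ (1 / α₁)`. -/
lemma log_coveringNumber_sub_isLittleO {H : Type*} [NormedAddCommGroup H] [InnerProductSpace ℝ H]
    [CompleteSpace H] {T : H →L[ℝ] H} (hcomp : IsCompactOperator T) (hT : T.IsPositive)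
    {ψ : ℕ → H} (hON : Orthonormal ℝ ψ)
    (hdense : (Submodule.span ℝ (Set.range ψ)).topologicalClosure = ⊤)
    {lam : ℕ → ℝ} (heig : ∀ n, T (ψ n) = lam n • ψ n) (hpos : ∀ n, 0 < lam n)
    (hanti : Antitone lam) {c α b γ : ℝ} (hc : 0 < c) (hα : 0 < α) (hγ : 1 / 2 < γ)
    (hlim : Tendsto (fun n : ℕ => lam n * ((n : ℝ) + 1) ^ α / c) atTop (𝓝 1))
    (hsum : (fun N : ℕ => ∑ n ∈ Finset.range N, Real.log (lam n)
      - (N * Real.log c - α * (N * Real.log N - N) + b / γ * (N : ℝ) ^ γ))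
      =o[atTop] fun N : ℕ => (N : ℝ) ^ γ) :
    (fun ε : ℝ => Real.log (coveringNumber ε (closure (T '' Metric.closedBall 0 1)))
      - α * (c / ε) ^ (1 / α) - b / γ * ((c / ε) ^ (1 / α)) ^ γ)
      =o[𝓝[>] 0] fun ε => ((c / ε) ^ (1 / α)) ^ γ := by
  have hinv : 0 < 1 / α := by positivity
  set y : ℝ → ℝ := fun ε => (c / ε) ^ (1 / α) with hydef
  set s : ℕ → ℝ := fun N => ∑ n ∈ Finset.range N, Real.log (lam n)
      - (N * Real.log c - α * (N * Real.log N - N) + b / γ * (N : ℝ) ^ γ) with hsdef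
  have hy : Tendsto y (𝓝[>] 0) atTop := by
    refine (tendsto_rpow_atTop hinv).comp ?_
    exact (tendsto_inv_nhdsGT_zero.const_mul_atTop hc).congr fun ε => (div_eq_mul_inv c ε).symm
  have hlogy : ∀ ε, 0 < ε → Real.log ε = Real.log c - α * Real.log (y ε) := fun ε hε => by
    rw [hydef, Real.log_rpow (div_pos hc hε), Real.log_div hc.ne' hε.ne']
    field_simp
    ring
  have hlam0 : Tendsto lam atTop (𝓝 0) := by
    have h1 : Tendsto (fun n : ℕ => ((n : ℝ) + 1) ^ (-α)) atTop (𝓝 0) :=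
      (tendsto_rpow_neg_atTop hα).comp
        (tendsto_atTop_add_const_right _ _ tendsto_natCast_atTop_atTop)
    have h2 := (hlim.mul h1).const_mul c
    simp only [mul_zero] at h2
    refine h2.congr fun n => ?_
    have hn : (0 : ℝ) < (n : ℝ) + 1 := by positivity
    rw [Real.rpow_neg hn.le]
    have := (Real.rpow_pos_of_pos hn α).ne'
    field_simp
  choose! D hD using fun δ (hδ : 0 < δ) => exists_counting_index hanti hlam0 hδ
  have hcount := tendsto_counting_mul_rpow hpos hc hα hlim hD
  set M : ℝ → ℕ := fun ε => ⌈y ε⌉₊ with hM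
  set q : ℝ → ℝ := fun ε => √(1 + 1 / M ε) with hq
  set δ : ℝ → ℝ := fun ε => ε / q ε with hδdef
  set d : ℝ → ℕ := fun ε => D (δ ε) with hd
  have hq1 : ∀ ε, 1 ≤ q ε := fun ε => Real.one_le_sqrt.2 (by simp)
  have hMtop : Tendsto M (𝓝[>] 0) atTop := tendsto_nat_ceil_atTop.comp hy
  have hqlim : Tendsto q (𝓝[>] 0) (𝓝 1) := by
    have h1 : Tendsto (fun ε => 1 + 1 / (M ε : ℝ)) (𝓝[>] 0) (𝓝 (1 + 0)) :=
      (tendsto_one_div_atTop_nhds_zero_nat.comp hMtop).const_add 1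
    have h2 := h1.sqrt
    rwa [add_zero, Real.sqrt_one] at h2
  have hδlim : Tendsto δ (𝓝[>] 0) (𝓝[>] 0) := by
    refine tendsto_nhdsWithin_iff.2 ⟨?_, ?_⟩
    · have := (tendsto_id.mono_left nhdsWithin_le_nhds : Tendsto id (𝓝[>] (0 : ℝ)) (𝓝 0)).div
        hqlim one_ne_zero
      rwa [zero_div] at this
    · filter_upwards [self_mem_nhdsWithin] with ε hε
      exact div_pos hε (one_pos.trans_le (hq1 ε))
  have hdlim : Tendsto (fun ε => d ε / y ε) (𝓝[>] 0) (𝓝 1) := by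
    have h1 := (hcount.comp hδlim).mul (hqlim.rpow_const (p := 1 / α) (Or.inl one_ne_zero))
    rw [Real.one_rpow, mul_one] at h1
    refine h1.congr' ?_
    filter_upwards [self_mem_nhdsWithin] with ε hε
    have hε0 : (0 : ℝ) < ε := hε
    have hq0 : 0 < q ε := one_pos.trans_le (hq1 ε)
    have e : δ ε / c * q ε = (c / ε)⁻¹ := by
      simp only [hδdef]
      field_simp
    simp only [Function.comp_apply]
    rw [mul_assoc, ← Real.mul_rpow (by positivity) hq0.le, e, Real.inv_rpow (by positivity)]
    rfl
  have hfloorlim : Tendsto (fun ε => ⌊y ε⌋₊ / y ε) (𝓝[>] 0) (𝓝 1) :=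
    tendsto_nat_floor_div_atTop.comp hy
  have hloglim : Tendsto (fun ε => Real.log (y ε)) (𝓝[>] 0) atTop := Real.tendsto_log_atTop.comp hy
  have hconst : ∀ C : ℝ, (fun _ => C) =o[𝓝[>] 0] fun ε => y ε ^ γ := fun C =>
    isLittleO_const_left.2 <| Or.inr <| tendsto_norm_atTop_atTop.comp <|
      (tendsto_rpow_atTop (by linarith)).comp hy
  have hover : (fun ε => √(y ε) * Real.log (y ε)) =o[𝓝[>] 0] fun ε => y ε ^ γ := by
    have h1 := ((isBigO_refl (fun x : ℝ => x ^ (1 / 2 : ℝ)) atTop).mul_isLittleO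
      (isLittleO_log_rpow_atTop (sub_pos.2 hγ))).comp_tendsto hy
    refine h1.congr' ?_ ?_
    · filter_upwards with ε
      simp [Real.sqrt_eq_rpow]
    · filter_upwards [hy.eventually_gt_atTop 0] with ε hε
      simp only [Function.comp_apply]
      rw [← Real.rpow_add hε, add_sub_cancel]
  have hlow := (isLittleO_rpow_of_tendsto_div (b / γ) hsum hy hfloorlim).sub (hconst α)
  have hup := (isLittleO_rpow_of_tendsto_div (b / γ) hsum hy hdlim).add
    ((hconst 1).add (hover.const_mul_left (8 * (α + 1) + 27)))
  refine isLittleO_of_eventually_le_le hlow hup ?_ ?_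
  · filter_upwards [self_mem_nhdsWithin, hy.eventually_ge_atTop 1] with ε hε hy1
    have h1 := sum_log_le_log_coveringNumber hcomp hT hON heig hpos hε ⌊y ε⌋₊
    rw [hlogy ε hε] at h1
    have h2 := mul_le_mul_of_nonneg_left (sub_one_le_mul_log_floor hy1) hα.le
    change b / γ * ((⌊y ε⌋₊ : ℝ) ^ γ - y ε ^ γ) + s ⌊y ε⌋₊ - α ≤ _ - α * y ε - b / γ * y ε ^ γ
    simp only [hsdef]
    linarith
  · filter_upwards [self_mem_nhdsWithin, hy.eventually_ge_atTop 241, hdlim.eventually_le_const one_lt_two,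
      hdlim.eventually_const_lt one_pos,
      hloglim.eventually_ge_atTop (Real.log (lam 0) - Real.log c + 1)] with ε hε hy1 hd2 hd0 hlogε
    have hε0 : (0 : ℝ) < ε := hε
    have hy0 : 0 < y ε := by linarith
    have hdy : (d ε : ℝ) ≤ 2 * y ε := (div_le_iff₀ hy0).1 hd2
    have hdpos : 0 < d ε := by
      have := (div_pos_iff_of_pos_right hy0).1 hd0
      exact_mod_cast this
    have hyM : y ε ≤ M ε := Nat.le_ceil _
    have hM2 : (M ε : ℝ) ≤ 2 * y ε := by linarith [Nat.ceil_lt_add_one hy0.le]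
    have hMpos : 0 < M ε := Nat.ceil_pos.2 hy0
    have hM0 : (0 : ℝ) < M ε := by exact_mod_cast hMpos
    have hsq : 1 ≤ √(y ε) := Real.one_le_sqrt.2 (by linarith)
    set m := ⌈√(y ε)⌉₊ with hmdef
    have hm : √(y ε) ≤ m := Nat.le_ceil _
    have hm2 : (m : ℝ) ≤ 2 * √(y ε) := by linarith [Nat.ceil_lt_add_one (Real.sqrt_nonneg (y ε))]
    have hmpos : 0 < m := Nat.ceil_pos.2 (by linarith)
    have hq0 : 0 < q ε := one_pos.trans_le (hq1 ε)
    have hδ0 : 0 < δ ε := div_pos hε0 hq0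
    have h1 := log_coveringNumber_le hT hON hdense heig hpos hanti hdpos hmpos hMpos hδ0
      (hD _ hδ0).1 (hD _ hδ0).2
    have hδq : δ ε * √(1 + 1 / M ε) = ε := div_mul_cancel₀ _ hq0.ne'
    rw [hδq] at h1
    have hlogq : Real.log (q ε) ≤ 1 / (2 * M ε) := by
      have := Real.log_le_sub_one_of_pos (show (0 : ℝ) < 1 + 1 / M ε by positivity)
      simp only [hq]
      rw [Real.log_sqrt (by positivity)]
      have e : 1 / (2 * (M ε : ℝ)) = (1 / M ε) / 2 := by field_simp
      rw [e]
      linarith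
    have hlogδ : Real.log (δ ε) = Real.log c - α * Real.log (y ε) - Real.log (q ε) := by
      rw [← hlogy ε hε0]
      exact Real.log_div hε0.ne' hq0.ne'
    have hdM : (d ε : ℝ) * Real.log (q ε) ≤ 1 := by
      refine (mul_le_mul_of_nonneg_left hlogq (Nat.cast_nonneg _)).trans ?_
      rw [mul_one_div, div_le_one (by positivity)]
      linarith
    have hlogq1 : Real.log (q ε) ≤ 1 := by
      refine hlogq.trans ?_
      rw [div_le_one (by positivity)]
      linarith
    have h2 := block_overhead_le (A := α + 1) (B := Real.log (lam 0) - Real.log (δ ε)) hy1 hdy hm hm2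
      hM2 (by positivity) (by rw [hlogδ]; linarith)
    have h3 := mul_le_mul_of_nonneg_left
      (mul_log_sub_mul_log_add_le hy0 (Nat.cast_nonneg (α := ℝ) (d ε))) hα.le
    have h4 : (d ε : ℝ) * Real.log (δ ε) =
        d ε * Real.log c - α * (d ε * Real.log (y ε)) - d ε * Real.log (q ε) := by
      rw [hlogδ]
      ring
    change _ - α * y ε - b / γ * y ε ^ γ ≤ b / γ * ((d ε : ℝ) ^ γ - y ε ^ γ) + s (d ε) +
      (1 + (8 * (α + 1) + 27) * (√(y ε) * Real.log (y ε)))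
    simp only [hsdef]
    linarith

theorem entropy_of_compact_operator_second_order
    {H : Type*} [NormedAddCommGroup H] [InnerProductSpace ℝ H] [CompleteSpace H]
    [SeparableSpace H]
    (T : H →L[ℝ] H) (hcomp : IsCompactOperator T) (hposop : T.IsPositive)
    -- `ψ` is an orthonormal basis of `H` consisting of eigenvectors of `T`,
    -- with eigenvalues `lam n` (here `lam n` is the eigenvalue `λ_{n+1}`),
    -- arranged in non-increasing order and counted with multiplicity
    (ψ : ℕ → H) (hON : Orthonormal ℝ ψ)
    (hdense : (Submodule.span ℝ (Set.range ψ)).topologicalClosure = ⊤)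
    (lam : ℕ → ℝ) (heig : ∀ n, T (ψ n) = lam n • ψ n)
    (hlampos : ∀ n, 0 < lam n) (hanti : Antitone lam)
    (c₁ c₂ α₁ α₂ : ℝ) (hc₁ : 0 < c₁) (hα₁ : 0 < α₁) (hα₂ : 0 < α₂)
    (hcase : (α₁ < α₂ ∧ α₂ < α₁ + 1 / 2) ∨ (α₁ = α₂ ∧ c₂ = 0))
    (hasymp : (fun n : ℕ => lam n - c₁ * ((n : ℝ) + 1) ^ (-α₁) - c₂ * ((n : ℝ) + 1) ^ (-α₂))
      =o[atTop] fun n : ℕ => ((n : ℝ) + 1) ^ (-α₂)) :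
    (fun ε : ℝ => opEntropy ε T
        - α₁ * c₁ ^ (1 / α₁) / Real.log 2 * ε ^ (-(1 / α₁))
        - c₂ * c₁ ^ ((1 - α₂) / α₁) / (Real.log 2 * (α₁ - α₂ + 1))
            * ε ^ (-((α₁ - α₂ + 1) / α₁)))
      =o[𝓝[>] 0] fun ε : ℝ => ε ^ (-((α₁ - α₂ + 1) / α₁)) := by
  set γ := α₁ - α₂ + 1 with hγ
  have hγ2 : 1 / 2 < γ := by rcases hcase with h | h <;> linarith [h.1, h.2]
  have hγ1 : γ ≤ 1 := by rcases hcase with h | h <;> linarith [h.1]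
  have hγ0 : 0 < γ := by linarith
  obtain ⟨hlim, hlog⟩ := log_sub_isLittleO hlampos hc₁ (hcase.imp_left And.left) hasymp
  have hexp : α₁ - α₂ = γ - 1 := by rw [hγ]; ring
  rw [hexp] at hlog
  have hmain := log_coveringNumber_sub_isLittleO hcomp hposop hON hdense heig hlampos hanti hc₁ hα₁
    hγ2 hlim (sum_log_sub_isLittleO hγ0 hγ1 hlog)
  have hpow : ∀ ε : ℝ, 0 < ε → ∀ p : ℝ, (c₁ / ε) ^ p = c₁ ^ p * ε ^ (-p) := fun ε hε p => by
    rw [Real.div_rpow hc₁.le hε.le, Real.rpow_neg hε.le, div_eq_mul_inv]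
  have hyγ : ∀ ε : ℝ, 0 < ε →
      ((c₁ / ε) ^ (1 / α₁)) ^ γ = c₁ ^ (γ / α₁) * ε ^ (-(γ / α₁)) := fun ε hε => by
    rw [← Real.rpow_mul (by positivity), one_div_mul_eq_div, hpow ε hε]
  have hcoef : c₂ / c₁ * c₁ ^ (γ / α₁) = c₂ * c₁ ^ ((1 - α₂) / α₁) := by
    have e : γ / α₁ = (1 - α₂) / α₁ + 1 := by rw [hγ]; field_simp; ring
    rw [e, Real.rpow_add_one hc₁.ne']
    field_simp
  have hlog2 : Real.log 2 ≠ 0 := (Real.log_pos one_lt_two).ne'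
  have hO : (fun ε : ℝ => ((c₁ / ε) ^ (1 / α₁)) ^ γ) =O[𝓝[>] 0] fun ε => ε ^ (-(γ / α₁)) := by
    refine ((isBigO_refl (fun ε : ℝ => ε ^ (-(γ / α₁))) _).const_mul_left (c₁ ^ (γ / α₁))).congr' ?_
      EventuallyEq.rfl
    filter_upwards [self_mem_nhdsWithin] with ε hε using (hyγ ε hε).symm
  refine ((hmain.trans_isBigO hO).const_mul_left (1 / Real.log 2)).congr' ?_ EventuallyEq.rfl
  filter_upwards [self_mem_nhdsWithin] with ε hε
  rw [hyγ ε hε, hpow ε hε, opEntropy, metricEntropy, Real.logb, ← hcoef]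
  field_simp
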